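/- In the renormalization setting: for every t > 0 one has u(x,t) > φ₀(x − c₀ t + l₀) for all x ∈ [c₀ t − 2l₀, c₀ t], and consequently b(t) > c₀ t for all t > 0; in particular b(t) → ∞ at least linearly. -/

import Mathlib

open MeasureTheory Set Filter

noncomputable section

/-- Condition (F1): `f` and `κ` are `C²`, 1-periodic in `x`, `f(x,0)=0`, and there is `θ > 0`
with `f(x,u) > 0` for `u > θ` and `κ(x) > θ`. -/
def CondF1 (f : ℝ → ℝ → ℝ) (κ : ℝ → ℝ) (θ : ℝ) : Prop :=
  ContDiff ℝ 2 (Function.uncurry f) ∧ ContDiff ℝ 2 κ ∧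
  (∀ x u, f (x + 1) u = f x u) ∧ (∀ x, κ (x + 1) = κ x) ∧
  (∀ x, f x 0 = 0) ∧ 0 < θ ∧ (∀ x u, θ < u → 0 < f x u) ∧ (∀ x, θ < κ x)

/-- `κ₀ := min κ` (over a period). -/
def kappaMin (κ : ℝ → ℝ) : ℝ := sInf (κ '' Icc 0 1)

/-- `κ⁰ := max κ` (over a period). -/
def kappaMax (κ : ℝ → ℝ) : ℝ := sSup (κ '' Icc 0 1)

/-- Condition (F2): existence of a compactly supported traveling subsolution profile `φ₀`
with speed `c₀`. -/
def CondF2 (m : ℝ) (f : ℝ → ℝ → ℝ) (κ : ℝ → ℝ) (c₀ l₀ : ℝ) (φ₀ : ℝ → ℝ) : Prop :=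
  0 < c₀ ∧ 0 < l₀ ∧ ContDiffOn ℝ 2 φ₀ (Icc (-l₀) l₀) ∧
  φ₀ (-l₀) = 0 ∧ φ₀ l₀ = 0 ∧ (∀ z ∈ Ioo (-l₀) l₀, 0 < φ₀ z) ∧
  c₀ < -(derivWithin φ₀ (Icc (-l₀) l₀) l₀) ∧
  ∀ (x : ℝ), ∀ z ∈ Icc (-l₀) l₀,
    0 ≤ derivWithin (derivWithin (fun w => φ₀ w ^ m) (Icc (-l₀) l₀)) (Icc (-l₀) l₀) z
        + c₀ * derivWithin φ₀ (Icc (-l₀) l₀) z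
        + f x (φ₀ z) * (κ x - φ₀ z)

/-- A (bounded, continuous) very weak solution of `u_t = (u^m)_{xx} + f(x,u)(κ(x)-u)`
on `ℝ × (0,τ)` with initial data `u₀`. -/
def VeryWeakSol (m : ℝ) (f : ℝ → ℝ → ℝ) (κ : ℝ → ℝ) (τ : ℝ)
    (u₀ : ℝ → ℝ) (u : ℝ → ℝ → ℝ) : Prop :=
  ContinuousOn (fun q : ℝ × ℝ => u q.1 q.2) (univ ×ˢ Ioc (0:ℝ) τ) ∧
  (∃ M : ℝ, ∀ x : ℝ, ∀ t ∈ Ioc (0:ℝ) τ, |u x t| ≤ M) ∧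
  ∀ φ : ℝ → ℝ → ℝ, ContDiff ℝ (⊤ : ℕ∞) (Function.uncurry φ) →
    HasCompactSupport (Function.uncurry φ) →
    ∫ x : ℝ, u x τ * φ x τ =
      (∫ x : ℝ, u₀ x * φ x 0)
      + (∫ t in Ioo (0:ℝ) τ, ∫ x : ℝ, f x (u x t) * (κ x - u x t) * φ x t)
      + (∫ t in Ioo (0:ℝ) τ, ∫ x : ℝ,
          (u x t * deriv (fun s => φ x s) t + u x t ^ m * deriv (deriv (fun y => φ y t)) x))

/-- A global very weak solution: a very weak solution on `ℝ × (0,τ)` for every `τ > 0`. -/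
def GlobalVeryWeakSol (m : ℝ) (f : ℝ → ℝ → ℝ) (κ : ℝ → ℝ)
    (u₀ : ℝ → ℝ) (u : ℝ → ℝ → ℝ) : Prop :=
  ∀ τ > (0:ℝ), VeryWeakSol m f κ τ u₀ u

/-- Left spatial derivative of the pressure `v = (m/(m-1)) u^{m-1}` at the point `z`
(at time `t`). -/
def pressureDx (m : ℝ) (u : ℝ → ℝ → ℝ) (z t : ℝ) : ℝ :=
  derivWithin (fun y => (m / (m - 1)) * u y t ^ (m - 1)) (Iic z) z

/-- The renormalization setting: (F1), (F2), a positive 1-periodic stationary solution `p`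
with `p ≥ κ₀` lying strictly above all translates of `φ₀`, a global very weak solution `u`
with Heaviside-type initial data `p·H(-x)` possessing a `C¹`, strictly increasing free
boundary `b → ∞` along which Darcy's law holds with nonnegative speed, and the crossing
times `ty y` defined by `b (ty y) = y` for `y > 0`. -/
def RenormSetting (m : ℝ) (f : ℝ → ℝ → ℝ) (κ : ℝ → ℝ) (θ c₀ l₀ : ℝ) (φ₀ p : ℝ → ℝ)
    (u : ℝ → ℝ → ℝ) (b : ℝ → ℝ) (ty : ℝ → ℝ) : Prop :=
  CondF1 f κ θ ∧ CondF2 m f κ c₀ l₀ φ₀ ∧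
  ContDiff ℝ 2 p ∧ (∀ x, 0 < p x) ∧ (∀ x, p (x + 1) = p x) ∧
  (∀ x, deriv (deriv (fun y => p y ^ m)) x + f x (p x) * (κ x - p x) = 0) ∧
  (∀ x, kappaMin κ ≤ p x) ∧
  (∀ x₀ : ℝ, ∀ x ∈ Icc (x₀ - l₀) (x₀ + l₀), φ₀ (x - x₀) < p x) ∧
  GlobalVeryWeakSol m f κ (fun x => if x ≤ 0 then p x else 0) u ∧
  (∀ t > (0:ℝ), DifferentiableAt ℝ b t) ∧
  ContinuousOn (deriv b) (Ioi 0) ∧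
  (∀ t > (0:ℝ), ∀ x : ℝ, (x < b t → 0 < u x t) ∧ (b t ≤ x → u x t = 0)) ∧
  StrictMonoOn b (Ioi 0) ∧
  Tendsto b atTop atTop ∧
  (∀ x t : ℝ, 0 < t → 0 < u x t →
      DifferentiableAt ℝ (fun s => u x s) t ∧
      DifferentiableAt ℝ (fun y => u y t) x ∧
      DifferentiableAt ℝ (deriv (fun y => u y t)) x) ∧
  (∀ t > (0:ℝ), deriv b t = -(pressureDx m u (b t) t) ∧ 0 ≤ deriv b t) ∧
  (∀ y > (0:ℝ), 0 < ty y ∧ b (ty y) = y)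

/-- Averaging a smooth probability density over a window of length `h`. -/
lemma exists_window_average {h r : ℝ} (hh : 0 < h) {f : ℝ → ℝ}
    (hf : ContDiff ℝ (⊤ : ℕ∞) f) (hf0 : ∀ x, 0 ≤ f x) (hf1 : ∫ x, f x = 1)
    (hfs : ∀ x, r ≤ |x| → f x = 0) :
    ∃ F : ℝ → ℝ, ContDiff ℝ (⊤ : ℕ∞) F ∧ (∀ x, 0 ≤ F x) ∧ ∫ x, F x = 1 ∧
      (∀ x, r + h / 2 ≤ |x| → F x = 0) ∧
      ∀ x, HasDerivAt F ((f (x + h / 2) - f (x - h / 2)) / h) x := by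
  have hc : Continuous f := hf.continuous
  have hP : ∀ x, HasDerivAt (fun z => ∫ t in (0:ℝ)..z, f t) (f x) x := fun x =>
    intervalIntegral.integral_hasDerivAt_right (hc.intervalIntegrable _ _)
      hc.stronglyMeasurable.stronglyMeasurableAtFilter hc.continuousAt
  set P : ℝ → ℝ := fun z => ∫ t in (0:ℝ)..z, f t with hPdef
  have hdP : deriv P = f := funext fun x => (hP x).deriv
  have hPs : ContDiff ℝ (⊤ : ℕ∞) P := by
    rw [contDiff_infty_iff_deriv]
    exact ⟨fun x => (hP x).differentiableAt, by rw [hdP]; exact hf⟩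
  have hF : ∀ x, (P (x + h / 2) - P (x - h / 2)) / h
      = (∫ t in (x - h / 2)..(x + h / 2), f t) / h := by
    intro x
    rw [hPdef]
    simp only
    rw [intervalIntegral.integral_interval_sub_left (hc.intervalIntegrable _ _)
      (hc.intervalIntegrable _ _)]
  have hcs : HasCompactSupport f := by
    apply HasCompactSupport.of_support_subset_isCompact (isCompact_Icc (a := -r) (b := r))
    intro x hx
    by_contra hcon
    apply hx
    apply hfs
    by_contra hlt
    exact hcon (abs_le.1 (not_le.1 hlt).le)
  refine ⟨fun x => (P (x + h / 2) - P (x - h / 2)) / h, ?_, ?_, ?_, ?_, ?_⟩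
  · fun_prop
  · intro x
    beta_reduce
    rw [hF]
    exact div_nonneg (intervalIntegral.integral_nonneg (by linarith) fun t _ => hf0 t) hh.le
  · have hconv : (fun x => (P (x + h / 2) - P (x - h / 2)) / h)
        = MeasureTheory.convolution ((Ioc (-(h / 2)) (h / 2)).indicator fun _ => 1 / h) f
          (ContinuousLinearMap.mul ℝ ℝ) volume := by
      funext x
      rw [hF, MeasureTheory.convolution]
      have : ∀ t, (ContinuousLinearMap.mul ℝ ℝ) ((Ioc (-(h / 2)) (h / 2)).indicator
          (fun _ => 1 / h) t) (f (x - t))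
          = (Ioc (-(h / 2)) (h / 2)).indicator (fun t => 1 / h * f (x - t)) t := by
        intro t
        by_cases ht : t ∈ Ioc (-(h / 2)) (h / 2) <;> simp [ht]
      simp_rw [this]
      rw [integral_indicator measurableSet_Ioc, ← intervalIntegral.integral_of_le (by linarith),
        intervalIntegral.integral_const_mul, intervalIntegral.integral_comp_sub_left]
      rw [sub_neg_eq_add]
      ring
    rw [hconv, integral_convolution]
    · rw [hf1, integral_indicator measurableSet_Ioc]
      simp [Real.volume_real_Ioc_of_le (show -(h / 2) ≤ h / 2 by linarith)]
      field_simp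
    · exact (integrable_indicator_iff measurableSet_Ioc).2 (integrableOn_const (by simp))
    · exact hc.integrable_of_hasCompactSupport hcs
  · intro x hx
    beta_reduce
    rw [hF, intervalIntegral.integral_congr (g := fun _ => 0)]
    · simp
    · intro t ht
      rw [uIcc_of_le (by linarith)] at ht
      apply hfs
      rcases le_abs.1 hx with hx | hx
      · exact le_abs.2 (Or.inl (by linarith [ht.1]))
      · exact le_abs.2 (Or.inr (by linarith [ht.2]))
  · intro x
    have h1 := (hP (x + h / 2)).comp x ((hasDerivAt_id x).add_const (h / 2))
    have h2 := (hP (x - h / 2)).comp x ((hasDerivAt_id x).sub_const (h / 2))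
    simpa using (h1.sub h2).div_const h

/-- Smooth probability densities `K`, `ρ` near the origin for which `K''` is the second
difference quotient of `ρ`. -/
lemma exists_kernel_pair {h : ℝ} (hh : 0 < h) :
    ∃ K K' ρ : ℝ → ℝ, ContDiff ℝ (⊤ : ℕ∞) K ∧ ContDiff ℝ (⊤ : ℕ∞) ρ ∧
      (∀ x, 0 ≤ K x) ∧ (∀ x, 0 ≤ ρ x) ∧ ∫ x, K x = 1 ∧ ∫ x, ρ x = 1 ∧
      (∀ x, 2 * h ≤ |x| → K x = 0) ∧ (∀ x, 2 * h ≤ |x| → ρ x = 0) ∧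
      (∀ x, HasDerivAt K (K' x) x) ∧
      ∀ x, HasDerivAt K' ((ρ (x + h) - 2 * ρ x + ρ (x - h)) / h ^ 2) x := by
  let β : ContDiffBump (0 : ℝ) := ⟨h / 2, h, by linarith, by linarith⟩
  have hs : ∀ x, h ≤ |x| → β.normed volume x = 0 := by
    intro x hx
    rw [← Function.notMem_support, β.support_normed_eq]
    simpa [β] using hx
  obtain ⟨F, hF, hF0, hF1, hFs, hFd⟩ := exists_window_average hh
    (β.contDiff_normed) (fun x => β.nonneg_normed x) (β.integral_normed) hs
  obtain ⟨K, hK, hK0, hK1, hKs, hKd⟩ := exists_window_average hh hF hF0 hF1 hFs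
  refine ⟨K, fun x => (F (x + h / 2) - F (x - h / 2)) / h, β.normed volume, hK,
    β.contDiff_normed, hK0, fun x => β.nonneg_normed x, hK1, β.integral_normed,
    fun x hx => hKs x (by linarith), fun x hx => hs x (by linarith), hKd, ?_⟩
  intro x
  have h1 := (hFd (x + h / 2)).comp x ((hasDerivAt_id x).add_const (h / 2))
  have h2 := (hFd (x - h / 2)).comp x ((hasDerivAt_id x).sub_const (h / 2))
  refine ((h1.sub h2).div_const h).congr_deriv ?_
  have e1 : x + h / 2 + h / 2 = x + h := by ring
  have e2 : x + h / 2 - h / 2 = x := by ring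
  have e3 : x - h / 2 + h / 2 = x := by ring
  have e4 : x - h / 2 - h / 2 = x - h := by ring
  rw [e1, e2, e3, e4]
  field_simp
  ring
/-- A continuous function times a translated compactly supported kernel is integrable. -/
lemma integrable_mul_kernel {g K : ℝ → ℝ} {r : ℝ} (hg : Continuous g) (hK : Continuous K)
    (hKs : ∀ x, r ≤ |x| → K x = 0) (x : ℝ) : Integrable fun z => g z * K (z - x) := by
  refine Continuous.integrable_of_hasCompactSupport (by fun_prop) ?_
  refine HasCompactSupport.of_support_subset_isCompact (isCompact_closedBall x r) ?_
  intro z hz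
  by_contra hcon
  apply hz
  rw [Metric.mem_closedBall, Real.dist_eq] at hcon
  simp [hKs (z - x) (not_le.1 hcon).le]

lemma integral_kernel_translate (K : ℝ → ℝ) (x : ℝ) : ∫ z, K (z - x) = ∫ z, K z :=
  integral_sub_right_eq_self K x

lemma le_integral_mul_kernel {g K : ℝ → ℝ} {r a x : ℝ}
    (hi : Integrable fun z => g z * K (z - x)) (hKi : Integrable K)
    (hK0 : ∀ x, 0 ≤ K x) (hK1 : ∫ x, K x = 1) (hKs : ∀ x, r ≤ |x| → K x = 0)
    (ha : ∀ z, |z - x| ≤ r → a ≤ g z) : a ≤ ∫ z, g z * K (z - x) := by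
  have h1 : ∫ z, a * K (z - x) = a := by
    rw [integral_const_mul, integral_kernel_translate, hK1, mul_one]
  rw [← h1]
  refine integral_mono ((hKi.comp_sub_right x).const_mul a) hi fun z => ?_
  by_cases hz : |z - x| ≤ r
  · exact mul_le_mul_of_nonneg_right (ha z hz) (hK0 _)
  · simp [hKs _ (not_le.1 hz).le]

lemma integral_mul_kernel_le {g K : ℝ → ℝ} {r b x : ℝ}
    (hi : Integrable fun z => g z * K (z - x)) (hKi : Integrable K)
    (hK0 : ∀ x, 0 ≤ K x) (hK1 : ∫ x, K x = 1) (hKs : ∀ x, r ≤ |x| → K x = 0)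
    (hb : ∀ z, |z - x| ≤ r → g z ≤ b) : ∫ z, g z * K (z - x) ≤ b := by
  have := le_integral_mul_kernel (g := fun z => - g z) (a := -b) (x := x)
    (by simpa using hi.neg) hKi hK0 hK1 hKs (fun z hz => neg_le_neg (hb z hz))
  simp only [neg_mul, integral_neg] at this
  linarith

lemma continuousOn_slice {g : ℝ → ℝ → ℝ} {T : ℝ}
    (hg : ContinuousOn (fun q : ℝ × ℝ => g q.1 q.2) (univ ×ˢ Ioc (0:ℝ) T)) {t : ℝ}
    (ht : t ∈ Ioc (0:ℝ) T) : Continuous fun z => g z t := by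
  rw [← continuousOn_univ]
  exact hg.comp (f := fun z : ℝ => (z, t)) (by fun_prop) fun z _ => ⟨mem_univ _, ht⟩

lemma continuousOn_integral_mul_kernel {g : ℝ → ℝ → ℝ} {K : ℝ → ℝ} {r T : ℝ}
    (hg : ContinuousOn (fun q : ℝ × ℝ => g q.1 q.2) (univ ×ˢ Ioc (0:ℝ) T))
    (hK : Continuous K) (hKs : ∀ x, r ≤ |x| → K x = 0) (x : ℝ) :
    ContinuousOn (fun t => ∫ z, g z t * K (z - x)) (Ioc 0 T) := by
  refine continuousOn_integral_of_compact_support (f := fun t z => g z t * K (z - x))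
    (isCompact_closedBall x r) ?_ ?_
  · refine ContinuousOn.mul ?_ (by fun_prop)
    exact hg.comp (f := fun q : ℝ × ℝ => (q.2, q.1)) (by fun_prop)
      fun q hq => ⟨mem_univ _, hq.1⟩
  · intro t z _ hz
    rw [Metric.mem_closedBall, Real.dist_eq] at hz
    simp [hKs (z - x) (not_le.1 hz).le]

lemma intervalIntegrable_integral_mul_kernel {g : ℝ → ℝ → ℝ} {K : ℝ → ℝ} {r T C : ℝ}
    (hg : ContinuousOn (fun q : ℝ × ℝ => g q.1 q.2) (univ ×ˢ Ioc (0:ℝ) T))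
    (hC : ∀ z, ∀ t ∈ Ioc (0:ℝ) T, |g z t| ≤ C)
    (hK : Continuous K) (hKi : Integrable K) (hKs : ∀ x, r ≤ |x| → K x = 0) (x : ℝ)
    {t t' : ℝ} (ht : 0 ≤ t) (htt : t ≤ t') (ht' : t' ≤ T) :
    IntervalIntegrable (fun t => ∫ z, g z t * K (z - x)) volume t t' := by
  rw [intervalIntegrable_iff_integrableOn_Ioc_of_le htt]
  have hsub : Ioc t t' ⊆ Ioc 0 T := Ioc_subset_Ioc ht ht'
  refine IntegrableOn.of_bound (C := ∫ z, C * |K (z - x)|) (by simp)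
    (((continuousOn_integral_mul_kernel hg hK hKs x).mono hsub).aestronglyMeasurable
      measurableSet_Ioc) ?_
  refine (ae_restrict_iff' measurableSet_Ioc).2 (Eventually.of_forall fun s hs => ?_)
  refine (norm_integral_le_integral_norm _).trans ?_
  refine integral_mono ((integrable_mul_kernel (continuousOn_slice hg (hsub hs)) hK hKs x).norm)
    (((hKi.comp_sub_right x).abs).const_mul C) fun z => ?_
  simp only [Real.norm_eq_abs, abs_mul]
  exact mul_le_mul_of_nonneg_right (hC z s (hsub hs)) (abs_nonneg _)

lemma time_average_bounds {g : ℝ → ℝ → ℝ} {K : ℝ → ℝ} {r T C : ℝ}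
    (hg : ContinuousOn (fun q : ℝ × ℝ => g q.1 q.2) (univ ×ˢ Ioc (0:ℝ) T))
    (hC : ∀ z, ∀ t ∈ Ioc (0:ℝ) T, |g z t| ≤ C)
    (hK : Continuous K) (hKi : Integrable K) (hK0 : ∀ x, 0 ≤ K x) (hK1 : ∫ x, K x = 1)
    (hKs : ∀ x, r ≤ |x| → K x = 0) (x : ℝ)
    {t t' : ℝ} (ht : 0 ≤ t) (htt : t ≤ t') (ht' : t' ≤ T) (a b : ℝ)
    (hab : ∀ z s, |z - x| ≤ r → t < s → s ≤ t' → a ≤ g z s ∧ g z s ≤ b) :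
    (t' - t) * a ≤ (∫ s in (0:ℝ)..t', ∫ z, g z s * K (z - x))
        - (∫ s in (0:ℝ)..t, ∫ z, g z s * K (z - x)) ∧
      (∫ s in (0:ℝ)..t', ∫ z, g z s * K (z - x))
        - (∫ s in (0:ℝ)..t, ∫ z, g z s * K (z - x)) ≤ (t' - t) * b := by
  have hii : ∀ {t t' : ℝ}, 0 ≤ t → t ≤ t' → t' ≤ T →
      IntervalIntegrable (fun t => ∫ z, g z t * K (z - x)) volume t t' := fun h1 h2 h3 =>
    intervalIntegrable_integral_mul_kernel hg hC hK hKi hKs x h1 h2 h3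
  rw [intervalIntegral.integral_interval_sub_left (hii le_rfl (ht.trans htt) ht')
    (hii le_rfl ht (htt.trans ht'))]
  have hi : ∀ s ∈ Ioc t t', Integrable fun z => g z s * K (z - x) := fun s hs =>
    integrable_mul_kernel (continuousOn_slice hg (Ioc_subset_Ioc ht ht' hs)) hK hKs x
  constructor
  · have := intervalIntegral.integral_mono_on_of_le_Ioo htt
      (intervalIntegrable_const (c := a) (μ := volume)) (hii ht htt ht') fun s hs =>
      le_integral_mul_kernel (hi s ⟨hs.1, hs.2.le⟩) hKi hK0 hK1 hKs
        fun z hz => (hab z s hz hs.1 hs.2.le).1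
    simpa using this
  · have := intervalIntegral.integral_mono_on_of_le_Ioo htt (hii ht htt ht')
      (intervalIntegrable_const (c := b) (μ := volume)) fun s hs =>
      integral_mul_kernel_le (hi s ⟨hs.1, hs.2.le⟩) hKi hK0 hK1 hKs
        fun z hz => (hab z s hz hs.1 hs.2.le).2
    simpa using this
/-- The weak formulation tested against `K(z - x) e^{Λ s}`. -/
lemma VeryWeakSol.integral_mul_kernel_eq {f : ℝ → ℝ → ℝ} {κ u₀ : ℝ → ℝ} {u : ℝ → ℝ → ℝ}
    {t Λ r : ℝ} (ht : 0 < t) (hsol : VeryWeakSol 2 f κ t u₀ u) {K K' K'' : ℝ → ℝ}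
    (hK : ContDiff ℝ (⊤ : ℕ∞) K) (hKs : ∀ x, r ≤ |x| → K x = 0)
    (hKd : ∀ x, HasDerivAt K (K' x) x) (hKd' : ∀ x, HasDerivAt K' (K'' x) x) (x : ℝ) :
    ∫ z, (Real.exp (Λ * t) * u z t) * K (z - x) = (∫ z, u₀ z * K (z - x))
      + (∫ s in (0:ℝ)..t, ∫ z, Real.exp (Λ * s) * (f z (u z s) * (κ z - u z s) * K (z - x)))
      + ∫ s in (0:ℝ)..t, ∫ z,
          Real.exp (Λ * s) * (Λ * u z s * K (z - x) + u z s ^ 2 * K'' (z - x)) := by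
  let χ : ContDiffBump (0 : ℝ) := ⟨t + 1, t + 2, by linarith, by linarith⟩
  have hχ1 : ∀ s, 0 ≤ s → s ≤ t → χ s = 1 := fun s h1 h2 =>
    χ.one_of_mem_closedBall (by
      rw [Metric.mem_closedBall, Real.dist_eq, sub_zero, abs_of_nonneg h1]
      change s ≤ t + 1
      linarith)
  have hχ1' : ∀ s, 0 < s → s < t → (χ : ℝ → ℝ) =ᶠ[nhds s] fun _ => 1 := fun s h1 h2 =>
    χ.eventuallyEq_one_of_mem_ball (by
      rw [Metric.mem_ball, Real.dist_eq, sub_zero, abs_of_pos h1]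
      change s < t + 1
      linarith)
  have key := hsol.2.2 (fun z s => K (z - x) * (χ s * Real.exp (Λ * s))) (by
      have : ContDiff ℝ (⊤ : ℕ∞) (χ : ℝ → ℝ) := χ.contDiff
      unfold Function.uncurry
      fun_prop) (by
      refine HasCompactSupport.of_support_subset_isCompact
        ((isCompact_closedBall x r).prod (isCompact_closedBall (0:ℝ) (t + 2))) ?_
      rintro ⟨z, s⟩ hz
      by_contra hcon
      apply hz
      simp only [mem_prod, not_and_or, Metric.mem_closedBall, Real.dist_eq] at hcon
      rcases hcon with hcon | hcon
      · simp [Function.uncurry, hKs (z - x) (not_le.1 hcon).le]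
      · have : χ s = 0 := χ.zero_of_le_dist (by
          rw [Real.dist_eq]
          exact (not_le.1 hcon).le)
        simp [Function.uncurry, this])
  rw [intervalIntegral.integral_of_le ht.le, intervalIntegral.integral_of_le ht.le,
    integral_Ioc_eq_integral_Ioo, integral_Ioc_eq_integral_Ioo]
  have e0 : ∫ z, (Real.exp (Λ * t) * u z t) * K (z - x)
      = ∫ z, u z t * (K (z - x) * (χ t * Real.exp (Λ * t))) := by
    congr 1
    funext z
    rw [hχ1 t ht.le le_rfl]
    ring
  have e1 : ∫ z, u₀ z * K (z - x) = ∫ z, u₀ z * (K (z - x) * (χ 0 * Real.exp (Λ * 0))) := by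
    congr 1
    funext z
    rw [hχ1 0 le_rfl ht.le]
    simp
  rw [e0, e1, key]
  congr 1
  · congr 1
    refine setIntegral_congr_fun measurableSet_Ioo fun s hs => ?_
    refine integral_congr_ae (Eventually.of_forall fun z => ?_)
    beta_reduce
    rw [hχ1 s hs.1.le hs.2.le]
    ring
  · refine setIntegral_congr_fun measurableSet_Ioo fun s hs => ?_
    refine integral_congr_ae (Eventually.of_forall fun z => ?_)
    beta_reduce
    have d1 : HasDerivAt (fun s => K (z - x) * (χ s * Real.exp (Λ * s)))
        (K (z - x) * (Λ * Real.exp (Λ * s))) s := by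
      have : HasDerivAt (fun s => K (z - x) * Real.exp (Λ * s))
          (K (z - x) * (Λ * Real.exp (Λ * s))) s := by
        refine (((hasDerivAt_id s).const_mul Λ).exp.const_mul (K (z - x))).congr_deriv ?_
        simp only [id_eq]
        ring
      refine this.congr_of_eventuallyEq ?_
      filter_upwards [hχ1' s hs.1 hs.2] with s' hs'
      rw [hs', one_mul]
    have d2 : deriv (fun y => K (y - x) * (χ s * Real.exp (Λ * s)))
        = fun y => K' (y - x) * (χ s * Real.exp (Λ * s)) := by
      funext y
      exact (((hKd (y - x)).comp_sub_const y x).mul_const _).deriv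
    have d3 : deriv (fun y => K' (y - x) * (χ s * Real.exp (Λ * s))) z
        = K'' (z - x) * (χ s * Real.exp (Λ * s)) :=
      (((hKd' (z - x)).comp_sub_const z x).mul_const _).deriv
    rw [d1.deriv, d2, d3, hχ1 s hs.1.le hs.2.le, Real.rpow_two]
    ring
/-- Averages at scale `h` of `y`, and of its sources `β y²` and `q` in space-time, which satisfy
the spatially discretised equation exactly. -/
def HasAverages (T : ℝ) (β : ℝ → ℝ) (y q : ℝ → ℝ → ℝ) : Prop :=
  ∀ h : ℝ, 0 < h → ∃ U J S : ℝ → ℝ → ℝ,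
    (∀ x t, 0 ≤ t → t ≤ T →
      U x t = U x 0 + (J (x + h) t - 2 * J x t + J (x - h) t) / h ^ 2 + S x t) ∧
    (∀ x, J x 0 = 0) ∧ (∀ x, S x 0 = 0) ∧
    (∀ x t a b, 0 ≤ t → t ≤ T → (∀ z, |z - x| ≤ 2 * h → a ≤ y z t ∧ y z t ≤ b) →
      a ≤ U x t ∧ U x t ≤ b) ∧
    (∀ x t t' a b, 0 ≤ t → t ≤ t' → t' ≤ T →
      (∀ z s, |z - x| ≤ 2 * h → t < s → s ≤ t' →
        a ≤ β s * y z s ^ 2 ∧ β s * y z s ^ 2 ≤ b) →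
      (t' - t) * a ≤ J x t' - J x t ∧ J x t' - J x t ≤ (t' - t) * b) ∧
    (∀ x t t' a b, 0 ≤ t → t ≤ t' → t' ≤ T →
      (∀ z s, |z - x| ≤ 2 * h → t < s → s ≤ t' → a ≤ q z s ∧ q z s ≤ b) →
      (t' - t) * a ≤ S x t' - S x t ∧ S x t' - S x t ≤ (t' - t) * b)

lemma VeryWeakSol.hasAverages {f : ℝ → ℝ → ℝ} {κ u₀ : ℝ → ℝ} {u : ℝ → ℝ → ℝ} {T Λ C : ℝ}
    (hT : 0 < T) (hf : Continuous (Function.uncurry f)) (hκ : Continuous κ)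
    (hu₀ : LocallyIntegrable u₀)
    (hsol : ∀ τ ∈ Ioc 0 T, VeryWeakSol 2 f κ τ u₀ u)
    (hC : ∀ z, ∀ t ∈ Ioc 0 T,
      |Real.exp (Λ * t) * (f z (u z t) * (κ z - u z t) + Λ * u z t)| ≤ C) :
    HasAverages T (fun t => Real.exp (-(Λ * t)))
      (fun z t => Real.exp (Λ * t) * if t ≤ 0 then u₀ z else u z t)
      (fun z t => Real.exp (Λ * t) * (f z (u z t) * (κ z - u z t) + Λ * u z t)) := by
  intro h hh
  obtain ⟨K, K', ρ, hK, hρ, hK0, hρ0, hK1, hρ1, hKs, hρs, hKd, hKd'⟩ := exists_kernel_pair hh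
  have hKi : Integrable K := integrable_of_integral_eq_one hK1
  have hρi : Integrable ρ := integrable_of_integral_eq_one hρ1
  have hucont := (hsol T ⟨hT, le_rfl⟩).1
  obtain ⟨M, hM⟩ := (hsol T ⟨hT, le_rfl⟩).2.1
  have hqc : ContinuousOn (fun p : ℝ × ℝ => Real.exp (Λ * p.2) *
      (f p.1 (u p.1 p.2) * (κ p.1 - u p.1 p.2) + Λ * u p.1 p.2)) (univ ×ˢ Ioc (0:ℝ) T) := by
    have h1 : ContinuousOn (fun p : ℝ × ℝ => f p.1 (u p.1 p.2)) (univ ×ˢ Ioc (0:ℝ) T) :=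
      hf.comp_continuousOn (f := fun p : ℝ × ℝ => (p.1, u p.1 p.2))
        (continuousOn_fst.prodMk hucont)
    have h2 : ContinuousOn (fun p : ℝ × ℝ => κ p.1) (univ ×ˢ Ioc (0:ℝ) T) := by fun_prop
    have h3 : ContinuousOn (fun p : ℝ × ℝ => Real.exp (Λ * p.2)) (univ ×ˢ Ioc (0:ℝ) T) := by
      fun_prop
    exact h3.mul ((h1.mul (h2.sub hucont)).add (continuousOn_const.mul hucont))
  have hpc : ContinuousOn (fun p : ℝ × ℝ => Real.exp (Λ * p.2) * u p.1 p.2 ^ 2)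
      (univ ×ˢ Ioc (0:ℝ) T) := by
    have h3 : ContinuousOn (fun p : ℝ × ℝ => Real.exp (Λ * p.2)) (univ ×ˢ Ioc (0:ℝ) T) := by
      fun_prop
    exact h3.mul (hucont.pow 2)
  have hpb : ∀ z, ∀ t ∈ Ioc 0 T, |Real.exp (Λ * t) * u z t ^ 2| ≤ Real.exp (|Λ| * T) * M ^ 2 := by
    intro z t ht
    rw [abs_mul, abs_of_pos (Real.exp_pos _), abs_pow]
    have h1 : Λ * t ≤ |Λ| * T :=
      (mul_le_mul_of_nonneg_right (le_abs_self Λ) ht.1.le).trans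
        (mul_le_mul_of_nonneg_left ht.2 (abs_nonneg _))
    exact mul_le_mul (Real.exp_le_exp.2 h1) (pow_le_pow_left₀ (abs_nonneg _) (hM z t ht) 2)
      (by positivity) (by positivity)
  refine ⟨fun x t => ∫ z, (Real.exp (Λ * t) * if t ≤ 0 then u₀ z else u z t) * K (z - x),
    fun x t => ∫ s in (0:ℝ)..t, ∫ z, (Real.exp (Λ * s) * u z s ^ 2) * ρ (z - x),
    fun x t => ∫ s in (0:ℝ)..t, ∫ z, (Real.exp (Λ * s) *
      (f z (u z s) * (κ z - u z s) + Λ * u z s)) * K (z - x), ?_, ?_, ?_, ?_, ?_, ?_⟩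
  · intro x t ht htT
    beta_reduce
    rcases ht.eq_or_lt with rfl | ht
    · simp
    have hmem : t ∈ Ioc 0 T := ⟨ht, htT⟩
    have key := (hsol t hmem).integral_mul_kernel_eq (Λ := Λ) ht hK hKs hKd hKd' x
    have hGc : ContinuousOn (fun p : ℝ × ℝ => Real.exp (Λ * p.2) *
        (f p.1 (u p.1 p.2) * (κ p.1 - u p.1 p.2))) (univ ×ˢ Ioc (0:ℝ) T) := by
      have h3 : ContinuousOn (fun p : ℝ × ℝ => Real.exp (Λ * p.2)) (univ ×ˢ Ioc (0:ℝ) T) := by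
        fun_prop
      refine (hqc.sub (h3.mul (continuousOn_const (c := Λ) |>.mul hucont))).congr
        fun p _ => ?_
      simp only [Pi.sub_apply, Pi.mul_apply]
      ring
    have hUc : ContinuousOn (fun p : ℝ × ℝ => Real.exp (Λ * p.2) * (Λ * u p.1 p.2))
        (univ ×ˢ Ioc (0:ℝ) T) := by
      have h3 : ContinuousOn (fun p : ℝ × ℝ => Real.exp (Λ * p.2)) (univ ×ˢ Ioc (0:ℝ) T) := by
        fun_prop
      exact h3.mul (continuousOn_const.mul hucont)
    have hUb : ∀ z, ∀ t ∈ Ioc 0 T,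
        |Real.exp (Λ * t) * (Λ * u z t)| ≤ Real.exp (|Λ| * T) * (|Λ| * M) := by
      intro z t ht
      rw [abs_mul, abs_of_pos (Real.exp_pos _), abs_mul]
      have h1 : Λ * t ≤ |Λ| * T :=
        (mul_le_mul_of_nonneg_right (le_abs_self Λ) ht.1.le).trans
          (mul_le_mul_of_nonneg_left ht.2 (abs_nonneg _))
      exact mul_le_mul (Real.exp_le_exp.2 h1)
        (mul_le_mul_of_nonneg_left (hM z t ht) (abs_nonneg _)) (by positivity) (by positivity)
    have hGb : ∀ z, ∀ t ∈ Ioc 0 T,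
        |Real.exp (Λ * t) * (f z (u z t) * (κ z - u z t))|
          ≤ C + Real.exp (|Λ| * T) * (|Λ| * M) := by
      intro z t ht
      have h1 := hC z t ht
      have h2 := hUb z t ht
      rw [mul_add] at h1
      rw [abs_le] at *
      constructor <;> linarith [h1.1, h1.2, h2.1, h2.2]
    have iG := intervalIntegrable_integral_mul_kernel hGc hGb hK.continuous hKi hKs x
      le_rfl ht.le htT
    have iU := intervalIntegrable_integral_mul_kernel hUc hUb hK.continuous hKi hKs x
      le_rfl ht.le htT
    have iP := fun x => intervalIntegrable_integral_mul_kernel hpc hpb hρ.continuous hρi hρs x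
      le_rfl ht.le htT
    have eS : (∫ s in (0:ℝ)..t, ∫ z, (Real.exp (Λ * s) *
          (f z (u z s) * (κ z - u z s) + Λ * u z s)) * K (z - x))
        = (∫ s in (0:ℝ)..t, ∫ z, (Real.exp (Λ * s) *
          (f z (u z s) * (κ z - u z s))) * K (z - x))
          + ∫ s in (0:ℝ)..t, ∫ z, (Real.exp (Λ * s) * (Λ * u z s)) * K (z - x) := by
      rw [← intervalIntegral.integral_add iG iU]
      refine intervalIntegral.integral_congr_ae (Eventually.of_forall fun s hs => ?_)
      rw [uIoc_of_le ht.le] at hs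
      have hs' := Ioc_subset_Ioc_right htT hs
      rw [← integral_add
        (integrable_mul_kernel (continuousOn_slice (g := fun z s => Real.exp (Λ * s) *
          (f z (u z s) * (κ z - u z s))) hGc hs') hK.continuous hKs x)
        (integrable_mul_kernel (continuousOn_slice (g := fun z s => Real.exp (Λ * s) *
          (Λ * u z s)) hUc hs') hK.continuous hKs x)]
      congr 1
      funext z
      ring
    have eJ : (∫ s in (0:ℝ)..t, ∫ z,
          Real.exp (Λ * s) * (Λ * u z s * K (z - x) + u z s ^ 2 *
            ((ρ (z - x + h) - 2 * ρ (z - x) + ρ (z - x - h)) / h ^ 2)))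
        = (∫ s in (0:ℝ)..t, ∫ z, (Real.exp (Λ * s) * (Λ * u z s)) * K (z - x))
          + ((∫ s in (0:ℝ)..t, ∫ z, (Real.exp (Λ * s) * u z s ^ 2) * ρ (z - (x + h)))
            - 2 * (∫ s in (0:ℝ)..t, ∫ z, (Real.exp (Λ * s) * u z s ^ 2) * ρ (z - x))
            + ∫ s in (0:ℝ)..t, ∫ z, (Real.exp (Λ * s) * u z s ^ 2) * ρ (z - (x - h)))
            / h ^ 2 := by
      rw [← intervalIntegral.integral_const_mul, ← intervalIntegral.integral_sub (iP _)
        ((iP x).const_mul 2), ← intervalIntegral.integral_add ((iP _).sub ((iP x).const_mul 2))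
        (iP _), ← intervalIntegral.integral_div,
        ← intervalIntegral.integral_add iU
          ((((iP _).sub ((iP x).const_mul 2)).add (iP _)).div_const _)]
      refine intervalIntegral.integral_congr_ae (Eventually.of_forall fun s hs => ?_)
      rw [uIoc_of_le ht.le] at hs
      have hs' := Ioc_subset_Ioc_right htT hs
      have jP := fun x => integrable_mul_kernel (continuousOn_slice
        (g := fun z s => Real.exp (Λ * s) * u z s ^ 2) hpc hs') hρ.continuous hρs x
      have jU := integrable_mul_kernel (continuousOn_slice
        (g := fun z s => Real.exp (Λ * s) * (Λ * u z s)) hUc hs') hK.continuous hKs x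
      have jD : Integrable fun z => Real.exp (Λ * s) * u z s ^ 2 * ρ (z - (x + h))
          - 2 * (Real.exp (Λ * s) * u z s ^ 2 * ρ (z - x)) :=
        (jP _).sub ((jP x).const_mul 2)
      have jE : Integrable fun z => (Real.exp (Λ * s) * u z s ^ 2 * ρ (z - (x + h))
          - 2 * (Real.exp (Λ * s) * u z s ^ 2 * ρ (z - x))
          + Real.exp (Λ * s) * u z s ^ 2 * ρ (z - (x - h))) / h ^ 2 :=
        (jD.add (jP _)).div_const _
      rw [← integral_const_mul, ← integral_sub (jP _) ((jP x).const_mul 2),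
        ← integral_add jD (jP _), ← integral_div, ← integral_add jU jE]
      congr 1
      funext z
      have a1 : z - x + h = z - (x - h) := by ring
      have a2 : z - x - h = z - (x + h) := by ring
      rw [a1, a2]
      ring
    have eG : (∫ s in (0:ℝ)..t, ∫ z,
          Real.exp (Λ * s) * (f z (u z s) * (κ z - u z s) * K (z - x)))
        = ∫ s in (0:ℝ)..t, ∫ z, (Real.exp (Λ * s) *
          (f z (u z s) * (κ z - u z s))) * K (z - x) := by
      simp only [mul_assoc]
    simp only [not_le.2 ht, if_false]
    rw [key, eS, eJ, eG]
    simp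
    ring
  · simp
  · simp
  · intro x t a b ht htT hab
    have hi : Integrable fun z =>
        (Real.exp (Λ * t) * if t ≤ 0 then u₀ z else u z t) * K (z - x) := by
      rcases ht.eq_or_lt with rfl | ht
      · have hcs : HasCompactSupport fun z => K (z - x) := by
          refine HasCompactSupport.of_support_subset_isCompact
            (isCompact_closedBall x (2 * h)) ?_
          intro z hz
          by_contra hcon
          apply hz
          rw [Metric.mem_closedBall, Real.dist_eq] at hcon
          exact hKs (z - x) (not_le.1 hcon).le
        have := hu₀.integrable_smul_right_of_hasCompactSupport
          (g := fun z => K (z - x)) (hK.continuous.comp (continuous_sub_right x)) hcs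
        simpa using this
      · simp only [not_le.2 ht, if_false]
        exact integrable_mul_kernel
          (continuous_const.mul (continuousOn_slice hucont ⟨ht, htT⟩)) hK.continuous hKs x
    exact ⟨le_integral_mul_kernel hi hKi hK0 hK1 hKs fun z hz => (hab z hz).1,
      integral_mul_kernel_le hi hKi hK0 hK1 hKs fun z hz => (hab z hz).2⟩
  · intro x t t' a b ht htt htT hab
    refine time_average_bounds hpc hpb hρ.continuous hρi hρ0 hρ1 hρs x ht htt htT a b ?_
    intro z s hz hs hs'
    have := hab z s hz hs hs'
    beta_reduce at this
    rw [if_neg (by linarith), mul_pow, ← mul_assoc, pow_two (Real.exp _), ← mul_assoc,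
      ← Real.exp_add, neg_add_cancel, Real.exp_zero, one_mul] at this
    exact this
  · intro x t t' a b ht htt htT hab
    exact time_average_bounds hqc hC hK.continuous hKi hK0 hK1 hKs x ht htt htT a b hab

/-- One explicit Euler step is monotone under the CFL condition. -/
lemma euler_step_mono {ν M a a' b b' c c' : ℝ} (hν : 0 ≤ ν) (hνM : 4 * ν * M ≤ 1)
    (ha : a ≤ a') (ha' : a' ≤ M) (hb0 : 0 ≤ b) (hb : b ≤ b') (hc0 : 0 ≤ c) (hc : c ≤ c') :
    a + ν * (b ^ 2 - 2 * a ^ 2 + c ^ 2) ≤ a' + ν * (b' ^ 2 - 2 * a' ^ 2 + c' ^ 2) := by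
  have h1 : b ^ 2 ≤ b' ^ 2 := pow_le_pow_left₀ hb0 hb 2
  have h2 : c ^ 2 ≤ c' ^ 2 := pow_le_pow_left₀ hc0 hc 2
  have h3 : 0 ≤ (a' - a) * (1 - 2 * ν * (a + a')) := by
    refine mul_nonneg (by linarith) ?_
    nlinarith [mul_le_mul_of_nonneg_left (show a + a' ≤ 2 * M by linarith) hν]
  nlinarith [mul_le_mul_of_nonneg_left h1 hν, mul_le_mul_of_nonneg_left h2 hν]

lemma abs_three_point_le {ν z h x b bp bm ε e : ℝ} (hν0 : 0 ≤ ν) (hν1 : 2 * ν ≤ 1)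
    (hb : |b| ≤ z * (1 + x ^ 2)) (hbp : |bp| ≤ z * (1 + (x + h) ^ 2))
    (hbm : |bm| ≤ z * (1 + (x - h) ^ 2)) (hε : |ε| ≤ e * (1 + x ^ 2)) :
    |(1 - 2 * ν) * b + ν * bp + ν * bm - ε|
      ≤ z * (1 + x ^ 2) + 2 * ν * h ^ 2 * z + e * (1 + x ^ 2) := by
  have hν2 : 0 ≤ 1 - 2 * ν := by linarith
  have b1 := abs_mul (1 - 2 * ν) b
  rw [abs_of_nonneg hν2] at b1
  have b2 := abs_mul ν bp
  have b3 := abs_mul ν bm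
  rw [abs_of_nonneg hν0] at b2 b3
  have t1 := mul_le_mul_of_nonneg_left hb hν2
  have t2 := mul_le_mul_of_nonneg_left hbp hν0
  have t3 := mul_le_mul_of_nonneg_left hbm hν0
  have t4 := abs_add_three ((1 - 2 * ν) * b) (ν * bp) (ν * bm)
  have t5 := abs_sub ((1 - 2 * ν) * b + ν * bp + ν * bm) ε
  linarith

/-- Stability of the difference scheme: a sequence of exact averages and the numerical solution
differ by the second difference of a small function. -/
lemma scheme_error {h μ τ M : ℝ} (hh : 0 < h) (hμ : 0 < μ) (hτ : τ = μ * h ^ 2)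
    (hM : 0 ≤ M) (hμM : 4 * μ * M ≤ 1) {β : ℕ → ℝ} {v U J S : ℕ → ℝ → ℝ} {e E : ℕ → ℝ} {N : ℕ}
    (hβ : ∀ k, k ≤ N → 0 ≤ β k ∧ β k ≤ 1)
    (hv : ∀ k x, k ≤ N → 0 ≤ v k x ∧ v k x ≤ M) (hU : ∀ k x, k ≤ N → 0 ≤ U k x ∧ U k x ≤ M)
    (hv0 : ∀ x, v 0 x = U 0 x) (hJ0 : ∀ x, J 0 x = 0) (hS0 : ∀ x, S 0 x = 0)
    (hvs : ∀ k x, v (k + 1) x = v k x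
      + μ * β k * (v k (x + h) ^ 2 - 2 * v k x ^ 2 + v k (x - h) ^ 2) + (S (k + 1) x - S k x))
    (hUs : ∀ k x, k ≤ N → U k x
      = U 0 x + (J k (x + h) - 2 * J k x + J k (x - h)) / h ^ 2 + S k x)
    (he0 : ∀ k, 0 ≤ e k) (hE0 : ∀ k, 0 ≤ E k) (hE : ∀ k, E k + τ * e k ≤ E (k + 1))
    (herr : ∀ k x, k < N →
      |J (k + 1) x - J k x - τ * β k * U k x ^ 2| ≤ τ * e k * (1 + x ^ 2)) :
    ∃ B : ℝ → ℝ, (∀ x, v N x - U N x = (B (x + h) - 2 * B x + B (x - h)) / h ^ 2) ∧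
      ∀ x, |B x| ≤ Real.exp (4 * M * (N * τ)) * E N * (1 + x ^ 2) := by
  have hτ0 : 0 < τ := by rw [hτ]; positivity
  set B : ℕ → ℝ → ℝ := fun k x =>
    ∑ j ∈ Finset.range k, (τ * β j * v j x ^ 2 - (J (j + 1) x - J j x)) with hB
  have hBs : ∀ k x, B (k + 1) x = B k x + (τ * β k * v k x ^ 2 - (J (k + 1) x - J k x)) :=
    fun k x => Finset.sum_range_succ _ _
  have hd : ∀ k, k ≤ N → ∀ x,
      v k x - U k x = (B k (x + h) - 2 * B k x + B k (x - h)) / h ^ 2 := by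
    intro k
    induction k with
    | zero => intro _ x; simp [hB, hv0]
    | succ k ih =>
      intro hk x
      have hk' : k ≤ N := by omega
      have i1 := ih hk' x
      have i2 := hUs k x hk'
      have i3 := hUs (k + 1) x hk
      rw [hvs, hBs, hBs, hBs]
      rw [eq_div_iff (by positivity)] at i1 ⊢
      have i4 : (U (k + 1) x - U k x - (S (k + 1) x - S k x)) * h ^ 2
          = (J (k + 1) (x + h) - 2 * J (k + 1) x + J (k + 1) (x - h))
            - (J k (x + h) - 2 * J k x + J k (x - h)) := by
        rw [i2, i3]
        field_simp
        ring
      rw [hτ]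
      linear_combination i1 - i4
  refine ⟨B N, hd N le_rfl, ?_⟩
  have hbd : ∀ k : ℕ, k ≤ N → ∀ x,
      |B k x| ≤ Real.exp (4 * M * (k * τ)) * E k * (1 + x ^ 2) := by
    intro k
    induction k with
    | zero =>
      intro _ x
      have := hE0 0
      simp only [hB, Finset.range_zero, Finset.sum_empty, abs_zero]
      positivity
    | succ k ih =>
      intro hk x
      have hk' : k ≤ N := by omega
      set z := Real.exp (4 * M * (k * τ)) * E k with hz
      have hz0 : 0 ≤ z := mul_nonneg (Real.exp_pos _).le (hE0 k)
      set s := v k x + U k x with hs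
      have hs0 : 0 ≤ s := add_nonneg (hv k x hk').1 (hU k x hk').1
      have hsM : s ≤ 2 * M := by linarith [(hv k x hk').2, (hU k x hk').2]
      set ν := μ * β k * s with hν
      have hν0 : 0 ≤ ν := mul_nonneg (mul_nonneg hμ.le (hβ k hk').1) hs0
      have hνs : ν ≤ μ * s := by
        have := mul_le_mul_of_nonneg_left (hβ k hk').2 (mul_nonneg hμ.le hs0)
        rw [hν]; linarith
      have hν1 : 2 * ν ≤ 1 := by linarith [mul_le_mul_of_nonneg_left hsM hμ.le]
      have i1 := hd k hk' x
      rw [eq_div_iff (by positivity)] at i1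
      have key : B (k + 1) x = (1 - 2 * ν) * B k x + ν * B k (x + h) + ν * B k (x - h)
          - (J (k + 1) x - J k x - τ * β k * U k x ^ 2) := by
        rw [hBs, hτ, hν, hs]
        linear_combination μ * β k * (v k x + U k x) * i1
      have step1 : |B (k + 1) x| ≤ z * (1 + x ^ 2) + 2 * ν * h ^ 2 * z
          + τ * e k * (1 + x ^ 2) := by
        rw [key]
        exact abs_three_point_le hν0 hν1 (ih hk' x) (ih hk' (x + h)) (ih hk' (x - h))
          (herr k x (by omega))
      have step2 : 2 * ν * h ^ 2 * z ≤ 4 * M * τ * z * (1 + x ^ 2) := by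
        have a1 : 2 * ν * h ^ 2 ≤ 4 * M * τ := by
          calc 2 * ν * h ^ 2 ≤ 2 * (μ * (2 * M)) * h ^ 2 := by
                have : ν ≤ μ * (2 * M) := hνs.trans (mul_le_mul_of_nonneg_left hsM hμ.le)
                gcongr
            _ = 4 * M * τ := by rw [hτ]; ring
        exact (mul_le_mul_of_nonneg_right a1 hz0).trans
          (le_mul_of_one_le_right (by positivity) (by linarith [sq_nonneg x]))
      have step3 : z + 4 * M * τ * z + τ * e k
          ≤ Real.exp (4 * M * ((k + 1 : ℕ) * τ)) * E (k + 1) := by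
        have g1 : Real.exp (4 * M * ((k + 1 : ℕ) * τ))
            = Real.exp (4 * M * (k * τ)) * Real.exp (4 * M * τ) := by
          rw [← Real.exp_add]
          push_cast
          ring_nf
        have g2 : 1 + 4 * M * τ ≤ Real.exp (4 * M * τ) := by
          linarith [Real.add_one_le_exp (4 * M * τ)]
        have g3 : 1 ≤ Real.exp (4 * M * ((k + 1 : ℕ) * τ)) := Real.one_le_exp (by positivity)
        have g4 : 0 ≤ τ * e k := mul_nonneg hτ0.le (he0 k)
        calc z + 4 * M * τ * z + τ * e k
            = Real.exp (4 * M * (k * τ)) * (1 + 4 * M * τ) * E k + 1 * (τ * e k) := by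
              rw [hz]; ring
          _ ≤ Real.exp (4 * M * ((k + 1 : ℕ) * τ)) * E k
              + Real.exp (4 * M * ((k + 1 : ℕ) * τ)) * (τ * e k) := by
              have := hE0 k
              refine add_le_add ?_ (mul_le_mul_of_nonneg_right g3 g4)
              rw [g1]
              gcongr
          _ = Real.exp (4 * M * ((k + 1 : ℕ) * τ)) * (E k + τ * e k) := by ring
          _ ≤ _ := mul_le_mul_of_nonneg_left (hE k) (Real.exp_pos _).le
      calc |B (k + 1) x| ≤ (z + 4 * M * τ * z + τ * e k) * (1 + x ^ 2) := by
            linarith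
        _ ≤ _ := mul_le_mul_of_nonneg_right step3 (by positivity)
  exact hbd N le_rfl

/-- A function whose second differences are bounded below near `x₀` grows quadratically. -/
lemma quadratic_growth {B : ℝ → ℝ} {x₀ h r η : ℝ} (hh : 0 < h)
    (hB : ∀ x, |x - x₀| ≤ r → η * h ^ 2 ≤ B (x + h) - 2 * B x + B (x - h)) (L : ℕ)
    (hL : L * h ≤ r) :
    η * (L * h) ^ 2 ≤ B (x₀ + L * h) + B (x₀ - L * h) - 2 * B x₀ := by
  set g : ℕ → ℝ := fun j => B (x₀ + j * h) + B (x₀ - j * h) with hg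
  have hj : ∀ j : ℕ, j ≤ L → (j : ℝ) * h ≤ r := fun j hjL =>
    (mul_le_mul_of_nonneg_right (Nat.cast_le.2 hjL) hh.le).trans hL
  have hr : 0 ≤ r := by simpa using hj 0 (Nat.zero_le _)
  have key : ∀ j : ℕ, j < L → (2 * j + 1) * (η * h ^ 2) ≤ g (j + 1) - g j := by
    intro j
    induction j with
    | zero =>
      intro _
      have := hB x₀ (by simpa using hr)
      simp only [hg]
      norm_num
      linarith
    | succ j ih =>
      intro hjL
      have i1 := ih (by omega)
      have hjr := hj (j + 1) (by omega)
      have p1 : (0:ℝ) ≤ ((j + 1 : ℕ) : ℝ) * h := by positivity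
      have b1 := hB (x₀ + (j + 1 : ℕ) * h) (by rwa [add_sub_cancel_left, abs_of_nonneg p1])
      have b2 := hB (x₀ - (j + 1 : ℕ) * h) (by
        rwa [sub_sub_cancel_left, abs_neg, abs_of_nonneg p1])
      have e1 : x₀ + ((j + 1 : ℕ) : ℝ) * h + h = x₀ + ((j + 1 + 1 : ℕ) : ℝ) * h := by
        push_cast; ring
      have e2 : x₀ + ((j + 1 : ℕ) : ℝ) * h - h = x₀ + (j : ℝ) * h := by push_cast; ring
      have e3 : x₀ - ((j + 1 : ℕ) : ℝ) * h + h = x₀ - (j : ℝ) * h := by push_cast; ring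
      have e4 : x₀ - ((j + 1 : ℕ) : ℝ) * h - h = x₀ - ((j + 1 + 1 : ℕ) : ℝ) * h := by
        push_cast; ring
      rw [e1, e2] at b1
      rw [e3, e4] at b2
      simp only [hg] at i1 ⊢
      push_cast at *
      linarith
  have main : ∀ j : ℕ, j ≤ L → (j : ℝ) ^ 2 * (η * h ^ 2) ≤ g j - g 0 := by
    intro j
    induction j with
    | zero => intro _; simp
    | succ j ih =>
      intro hjL
      have i1 := ih (by omega)
      have i2 := key j (by omega)
      push_cast
      linarith
  have := main L le_rfl
  simp only [hg, Nat.cast_zero, zero_mul, add_zero, sub_zero] at this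
  linarith

/-- The time increments of the averaged flux are close to those of an explicit Euler step. -/
lemma averages_consistency {T M μ δ t₁ : ℝ} (hM : 0 ≤ M) (hμ : 0 < μ) (hδ : 0 < δ)
    (ht₁ : 0 < t₁) {β : ℝ → ℝ} {y : ℝ → ℝ → ℝ} (hβc : Continuous β)
    (hβ : ∀ t, 0 ≤ t → 0 ≤ β t ∧ β t ≤ 1)
    (hy : ∀ x t, 0 ≤ t → t ≤ T → 0 ≤ y x t ∧ y x t ≤ M)
    (hyc : ContinuousOn (fun p : ℝ × ℝ => y p.1 p.2) (univ ×ˢ Ioc (0:ℝ) T)) :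
    ∃ h₁ > 0, ∀ h, 0 < h → h < h₁ → ∀ U J : ℝ → ℝ → ℝ,
      (∀ x t a b, 0 ≤ t → t ≤ T → (∀ z, |z - x| ≤ 2 * h → a ≤ y z t ∧ y z t ≤ b) →
        a ≤ U x t ∧ U x t ≤ b) →
      (∀ x t t' a b, 0 ≤ t → t ≤ t' → t' ≤ T →
        (∀ z s, |z - x| ≤ 2 * h → t < s → s ≤ t' →
          a ≤ β s * y z s ^ 2 ∧ β s * y z s ^ 2 ≤ b) →
        (t' - t) * a ≤ J x t' - J x t ∧ J x t' - J x t ≤ (t' - t) * b) →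
      ∀ x t, 0 ≤ t → t + μ * h ^ 2 ≤ T →
        |J x (t + μ * h ^ 2) - J x t - μ * h ^ 2 * β t * U x t ^ 2|
          ≤ μ * h ^ 2 * (if t < t₁ then M ^ 2 else δ) * (1 + x ^ 2) := by
  set R := M ^ 2 / δ + 1 with hR
  have hR1 : 1 ≤ R := by rw [hR]; linarith [show 0 ≤ M ^ 2 / δ by positivity]
  have hRδ : M ^ 2 ≤ δ * (1 + R ^ 2) := by
    have : M ^ 2 = δ * (R - 1) := by rw [hR]; field_simp; ring
    rw [this]
    exact mul_le_mul_of_nonneg_left (by nlinarith) hδ.le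
  have hcpt : IsCompact (Icc (-R - 1) (R + 1) ×ˢ Icc t₁ T) := isCompact_Icc.prod isCompact_Icc
  have hsub : Icc (-R - 1) (R + 1) ×ˢ Icc t₁ T ⊆ univ ×ˢ Ioc (0:ℝ) T := fun p hp =>
    ⟨mem_univ _, lt_of_lt_of_le ht₁ hp.2.1, hp.2.2⟩
  have hyu := hcpt.uniformContinuousOn_of_continuous (hyc.mono hsub)
  have hfc : ContinuousOn (fun p : ℝ × ℝ => β p.2 * y p.1 p.2 ^ 2) (univ ×ˢ Ioc (0:ℝ) T) :=
    (hβc.comp continuous_snd).continuousOn.mul (hyc.pow 2)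
  have hfu := hcpt.uniformContinuousOn_of_continuous (hfc.mono hsub)
  rw [Metric.uniformContinuousOn_iff] at hyu hfu
  set η := δ / (1 + 2 * M) with hη
  have hη0 : 0 < η := by positivity
  obtain ⟨d₁, hd₁, hyu⟩ := hyu η hη0
  obtain ⟨d₂, hd₂, hfu⟩ := hfu η hη0
  have hd : 0 < min d₁ d₂ := lt_min hd₁ hd₂
  refine ⟨min (1 / 2) (min (min d₁ d₂ / 4) (min d₁ d₂ / (2 * μ))), by positivity, ?_⟩
  intro h hh hh1 U J hU hJ x t ht htT
  obtain ⟨hh2, hh1⟩ := lt_min_iff.1 hh1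
  obtain ⟨hh3, hh4⟩ := lt_min_iff.1 hh1
  rw [lt_div_iff₀ (by positivity)] at hh4
  set τ := μ * h ^ 2 with hτ
  have hτ0 : 0 < τ := by positivity
  have hτd : τ < min d₁ d₂ := by
    have : μ * h ^ 2 ≤ μ * h := mul_le_mul_of_nonneg_left (by nlinarith) hμ.le
    nlinarith
  have htT' : t ≤ T := by linarith
  have hst : ∀ z s, t < s → s ≤ t + τ → 0 ≤ β s * y z s ^ 2 ∧ β s * y z s ^ 2 ≤ M ^ 2 := by
    intro z s hs hs'
    have h1 := hβ s (by linarith)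
    have h2 := hy z s (by linarith) (by linarith)
    have h3 : y z s ^ 2 ≤ M ^ 2 := pow_le_pow_left₀ h2.1 h2.2 2
    exact ⟨mul_nonneg h1.1 (sq_nonneg _), (mul_le_of_le_one_left (sq_nonneg _) h1.2).trans h3⟩
  have hU0 := hU x t 0 M ht htT' fun z _ => hy z t ht htT'
  have hβt := hβ t ht
  have crude : |J x (t + τ) - J x t - τ * β t * U x t ^ 2| ≤ τ * M ^ 2 := by
    have h1 := hJ x t (t + τ) 0 (M ^ 2) ht (by linarith) htT fun z s _ h2 h3 => hst z s h2 h3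
    have h2 : 0 ≤ β t * U x t ^ 2 := mul_nonneg hβt.1 (sq_nonneg _)
    have h3 : β t * U x t ^ 2 ≤ M ^ 2 :=
      (mul_le_of_le_one_left (sq_nonneg _) hβt.2).trans (pow_le_pow_left₀ hU0.1 hU0.2 2)
    have h4 := mul_le_mul_of_nonneg_left h2 hτ0.le
    have h5 := mul_le_mul_of_nonneg_left h3 hτ0.le
    rw [abs_le]
    constructor <;> linarith [h1.1, h1.2]
  split_ifs with htt
  · exact crude.trans (le_mul_of_one_le_right (by positivity) (by linarith [sq_nonneg x]))
  rw [not_lt] at htt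
  rcases le_total R |x| with hx | hx
  · refine crude.trans ?_
    rw [mul_assoc τ]
    refine mul_le_mul_of_nonneg_left (hRδ.trans ?_) hτ0.le
    have : R ^ 2 ≤ x ^ 2 := by
      rw [← sq_abs x]
      exact pow_le_pow_left₀ (by linarith) hx 2
    gcongr
  · have hx' := abs_le.1 hx
    have mem : ∀ z s, |z - x| ≤ 2 * h → t ≤ s → s ≤ t + τ →
        (z, s) ∈ Icc (-R - 1) (R + 1) ×ˢ Icc t₁ T := by
      intro z s hz hs hs'
      have := abs_le.1 hz
      exact ⟨⟨by linarith, by linarith⟩, ⟨by linarith, by linarith⟩⟩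
    have near : ∀ z s, |z - x| ≤ 2 * h → t ≤ s → s ≤ t + τ →
        dist ((z, s) : ℝ × ℝ) (x, t) < min d₁ d₂ := by
      intro z s hz hs hs'
      rw [Prod.dist_eq, Real.dist_eq, Real.dist_eq, max_lt_iff]
      refine ⟨by linarith, ?_⟩
      rw [abs_of_nonneg (by linarith)]
      linarith
    have memx := mem x t (by simpa using hh.le) le_rfl (by linarith)
    have h1 := hU x t (y x t - η) (y x t + η) ht htT' fun z hz => by
      have := hyu _ (mem z t hz le_rfl (by linarith)) _ memx
        ((near z t hz le_rfl (by linarith)).trans_le (min_le_left _ _))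
      rw [Real.dist_eq, abs_lt] at this
      constructor <;> linarith [this.1, this.2]
    have h2 := hJ x t (t + τ) (β t * y x t ^ 2 - η) (β t * y x t ^ 2 + η) ht (by linarith) htT
      fun z s hz hs hs' => by
        have := hfu _ (mem z s hz hs.le hs') _ memx
          ((near z s hz hs.le hs').trans_le (min_le_right _ _))
        rw [Real.dist_eq, abs_lt] at this
        constructor <;> linarith [this.1, this.2]
    have hyt := hy x t ht htT'
    have h3 : |β t * (y x t ^ 2 - U x t ^ 2)| ≤ 2 * M * η := by
      have e : y x t ^ 2 - U x t ^ 2 = (y x t + U x t) * (y x t - U x t) := by ring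
      rw [e, abs_mul, abs_mul, abs_of_nonneg hβt.1,
        abs_of_nonneg (show 0 ≤ y x t + U x t by linarith [hU0.1])]
      have a1 : |y x t - U x t| ≤ η := abs_le.2 ⟨by linarith [h1.2], by linarith [h1.1]⟩
      calc β t * ((y x t + U x t) * |y x t - U x t|) ≤ 1 * ((2 * M) * η) := by
            refine mul_le_mul hβt.2 (mul_le_mul (by linarith [hU0.2]) a1 (abs_nonneg _)
              (by linarith)) ?_ zero_le_one
            exact mul_nonneg (by linarith [hU0.1]) (abs_nonneg _)
        _ = 2 * M * η := one_mul _
    have h4 : η * (1 + 2 * M) = δ := by rw [hη]; field_simp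
    have h5 : |J x (t + τ) - J x t - τ * β t * U x t ^ 2| ≤ τ * δ := by
      have e : J x (t + τ) - J x t - τ * β t * U x t ^ 2
          = (J x (t + τ) - J x t - τ * (β t * y x t ^ 2))
            + τ * (β t * (y x t ^ 2 - U x t ^ 2)) := by ring
      rw [e]
      refine (abs_add_le _ _).trans ?_
      rw [abs_mul τ, abs_of_pos hτ0]
      have a1 : |J x (t + τ) - J x t - τ * (β t * y x t ^ 2)| ≤ τ * η :=
        abs_le.2 ⟨by linarith [h2.1], by linarith [h2.2]⟩
      have a2 := mul_le_mul_of_nonneg_left h3 hτ0.le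
      rw [← h4]
      linarith
    exact h5.trans (le_mul_of_one_le_right (by positivity) (by linarith [sq_nonneg x]))

lemma exists_mesh {T μ h₁ : ℝ} (hT : 0 < T) (hμ : 0 < μ) (hh₁ : 0 < h₁) :
    ∃ h, 0 < h ∧ h < h₁ ∧ ∃ N : ℕ, (N : ℝ) * (μ * h ^ 2) = T := by
  obtain ⟨N, hN⟩ := exists_nat_gt (T / (μ * h₁ ^ 2))
  have hN0 : (0:ℝ) < N := lt_trans (by positivity) hN
  have h0 : 0 < T / (N * μ) := by positivity
  refine ⟨√(T / (N * μ)), Real.sqrt_pos.2 h0, ?_, N, ?_⟩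
  · rw [Real.sqrt_lt' hh₁, div_lt_iff₀ (by positivity)]
    rw [div_lt_iff₀ (by positivity)] at hN
    linarith
  · rw [Real.sq_sqrt h0.le]
    field_simp

/-- Comparison principle: a function that is a subsolution of the explicit difference scheme
on all fine meshes lies below any function with the averaging property. -/
theorem HasAverages.comparison {T M C μ : ℝ} {β : ℝ → ℝ} {y q Y : ℝ → ℝ → ℝ}
    (hT : 0 < T) (hM : 0 < M) (hC : 0 ≤ C) (hμ : 0 < μ) (hμM : 4 * μ * (M + T * C) ≤ 1)
    (hav : HasAverages T β y q) (hβc : Continuous β) (hβ : ∀ t, 0 ≤ t → 0 ≤ β t ∧ β t ≤ 1)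
    (hy : ∀ x t, 0 ≤ t → t ≤ T → 0 ≤ y x t ∧ y x t ≤ M)
    (hq : ∀ x t, 0 < t → t ≤ T → 0 ≤ q x t ∧ q x t ≤ C)
    (hyc : ContinuousOn (fun p : ℝ × ℝ => y p.1 p.2) (univ ×ˢ Ioc (0:ℝ) T))
    (hY : ∀ x t, 0 ≤ t → t ≤ T → 0 ≤ Y x t) (hYc : Continuous fun x => Y x T)
    (h0 : ∃ h₀ > 0, ∀ h, 0 < h → h < h₀ → ∀ x z, |z - x| ≤ 2 * h → Y x 0 ≤ y z 0)
    (hsub : ∃ h₀ > 0, ∀ h, 0 < h → h < h₀ → ∀ x t, 0 ≤ t → t + μ * h ^ 2 ≤ T → ∃ a,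
      (∀ z s, |z - x| ≤ 2 * h → t < s → s ≤ t + μ * h ^ 2 → a ≤ q z s) ∧
      Y x (t + μ * h ^ 2) ≤ Y x t
        + μ * β t * (Y (x + h) t ^ 2 - 2 * Y x t ^ 2 + Y (x - h) t ^ 2) + μ * h ^ 2 * a) :
    ∀ x, Y x T ≤ y x T := by
  intro x₀
  by_contra! hcon
  set η := (Y x₀ T - y x₀ T) / 3 with hη
  have hη0 : 0 < η := by rw [hη]; linarith
  have hyTc : Continuous fun x => y x T := continuousOn_slice hyc ⟨hT, le_rfl⟩
  obtain ⟨r₁, hr₁, hYr⟩ := Metric.continuous_iff.1 hYc x₀ η hη0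
  obtain ⟨r₂, hr₂, hyr⟩ := Metric.continuous_iff.1 hyTc x₀ η hη0
  set r := min r₁ r₂ / 3 with hr
  have hmin : 0 < min r₁ r₂ := lt_min hr₁ hr₂
  have hr0 : 0 < r := by positivity
  have hrr₁ : 3 * r ≤ r₁ := by rw [hr]; linarith [min_le_left r₁ r₂]
  have hrr₂ : 3 * r ≤ r₂ := by rw [hr]; linarith [min_le_right r₁ r₂]
  obtain ⟨hA, hhA, h0⟩ := h0
  obtain ⟨hB, hhB, hsub⟩ := hsub
  set M₂ := M + T * C with hM₂
  have hM₂0 : 0 < M₂ := by positivity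
  have hMM₂ : M ≤ M₂ := by rw [hM₂]; linarith [mul_nonneg hT.le hC]
  set W := 1 + (|x₀| + r) ^ 2 with hW
  have hW0 : 0 < W := by positivity
  set ex := Real.exp (4 * M₂ * T) with hex
  have hex0 : 0 < ex := Real.exp_pos _
  set ω := η * r ^ 2 / (17 * W * ex) with hω
  have hω0 : 0 < ω := by positivity
  set t₁ := ω / (4 * M ^ 2) with ht₁
  have ht₁0 : 0 < t₁ := by positivity
  set δ := ω / (2 * T) with hδ
  have hδ0 : 0 < δ := by positivity
  obtain ⟨hD, hhD, hcons⟩ := averages_consistency (μ := μ) hM.le hμ hδ0 ht₁0 hβc hβ hy hyc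
  obtain ⟨h, hh, hhmin, N, hN⟩ := exists_mesh (h₁ := min (min hA hB) (min (min hD (r / 2))
    (min 1 (t₁ / μ)))) hT hμ (by positivity)
  obtain ⟨hm1, hm2⟩ := lt_min_iff.1 hhmin
  obtain ⟨hmA, hmB⟩ := lt_min_iff.1 hm1
  obtain ⟨hm3, hm4⟩ := lt_min_iff.1 hm2
  obtain ⟨hmD, hmr⟩ := lt_min_iff.1 hm3
  obtain ⟨hm1, hmt⟩ := lt_min_iff.1 hm4
  rw [lt_div_iff₀ hμ] at hmt
  set τ := μ * h ^ 2 with hτ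
  have hτ0 : 0 < τ := by positivity
  have hτt : τ ≤ t₁ := by nlinarith
  obtain ⟨U, J, S, hUeq, hJ0, hS0, hU, hJ, hS⟩ := hav h hh
  have tk0 : ∀ k : ℕ, 0 ≤ k * τ := fun k => by positivity
  have tkT : ∀ k : ℕ, k ≤ N → k * τ ≤ T := fun k hk => by
    rw [← hN]
    exact mul_le_mul_of_nonneg_right (Nat.cast_le.2 hk) hτ0.le
  have tks : ∀ k : ℕ, ((k + 1 : ℕ) : ℝ) * τ = k * τ + τ := fun k => by push_cast; ring
  let v : ℕ → ℝ → ℝ := fun k => Nat.rec (fun x => U x 0)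
    (fun k w x => w x + μ * β (k * τ) * (w (x + h) ^ 2 - 2 * w x ^ 2 + w (x - h) ^ 2)
      + (S x ((k + 1 : ℕ) * τ) - S x (k * τ))) k
  have hv0 : ∀ x, v 0 x = U x 0 := fun x => rfl
  have hvs : ∀ k x, v (k + 1) x = v k x
      + μ * β (k * τ) * (v k (x + h) ^ 2 - 2 * v k x ^ 2 + v k (x - h) ^ 2)
      + (S x ((k + 1 : ℕ) * τ) - S x (k * τ)) := fun k x => rfl
  have hU01 : ∀ x t, 0 ≤ t → t ≤ T → 0 ≤ U x t ∧ U x t ≤ M := fun x t h1 h2 =>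
    hU x t 0 M h1 h2 fun z _ => hy z t h1 h2
  have hSk : ∀ k : ℕ, k + 1 ≤ N → ∀ x, 0 ≤ S x ((k + 1 : ℕ) * τ) - S x (k * τ) ∧
      S x ((k + 1 : ℕ) * τ) - S x (k * τ) ≤ τ * C := by
    intro k hk x
    have h1 := tkT _ hk
    have := hS x (k * τ) ((k + 1 : ℕ) * τ) 0 C (tk0 k) (by rw [tks]; linarith) h1
      fun z s _ hs hs' => hq z s ((tk0 k).trans_lt hs) (hs'.trans h1)
    rw [tks] at this ⊢
    rw [add_sub_cancel_left] at this
    simpa using this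
  have hvb : ∀ k : ℕ, k ≤ N → ∀ x, 0 ≤ v k x ∧ v k x ≤ M + k * τ * C := by
    intro k
    induction k with
    | zero =>
      intro _ x
      have := hU01 x 0 le_rfl hT.le
      rw [hv0]
      simpa using this
    | succ k ih =>
      intro hk x
      have i := ih (by omega)
      have hS1 := hSk k hk x
      have hβk := hβ (k * τ) (tk0 k)
      have hν : 0 ≤ μ * β (k * τ) := mul_nonneg hμ.le hβk.1
      have hm : M + k * τ * C ≤ M₂ := by
        rw [hM₂]
        linarith [mul_le_mul_of_nonneg_right (tkT k (by omega)) hC]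
      have hνM : 4 * (μ * β (k * τ)) * M₂ ≤ 1 := by
        have := mul_le_of_le_one_right (show 0 ≤ 4 * μ * M₂ by positivity) hβk.2
        linarith
      have l1 := euler_step_mono hν hνM (i x).1 ((i x).2.trans hm) le_rfl
        (i (x + h)).1 le_rfl (i (x - h)).1
      have l2 := euler_step_mono hν hνM (i x).2 hm (i (x + h)).1 (i (x + h)).2
        (i (x - h)).1 (i (x - h)).2
      rw [hvs, tks]
      rw [tks] at hS1
      constructor
      · linarith [hS1.1]
      · linarith [hS1.2]
  have hvM : ∀ k : ℕ, k ≤ N → ∀ x, 0 ≤ v k x ∧ v k x ≤ M₂ := fun k hk x =>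
    ⟨(hvb k hk x).1, (hvb k hk x).2.trans (by
      rw [hM₂]
      linarith [mul_le_mul_of_nonneg_right (tkT k hk) hC])⟩
  have hvY : ∀ k : ℕ, k ≤ N → ∀ x, Y x (k * τ) ≤ v k x := by
    intro k
    induction k with
    | zero =>
      intro _ x
      have := hU x 0 (Y x 0) M le_rfl hT.le fun z hz =>
        ⟨h0 h hh hmA x z hz, (hy z 0 le_rfl hT.le).2⟩
      rw [hv0]
      simpa using this.1
    | succ k ih =>
      intro hk x
      have i := ih (by omega)
      have hkT := tkT (k + 1) hk
      rw [tks] at hkT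
      obtain ⟨a, ha, hYa⟩ := hsub h hh hmB x (k * τ) (tk0 k) hkT
      have hβk := hβ (k * τ) (tk0 k)
      have hν : 0 ≤ μ * β (k * τ) := mul_nonneg hμ.le hβk.1
      have hνM : 4 * (μ * β (k * τ)) * M₂ ≤ 1 := by
        have := mul_le_of_le_one_right (show 0 ≤ 4 * μ * M₂ by positivity) hβk.2
        linarith
      have hS1 := (hS x (k * τ) (k * τ + τ) a C (tk0 k) (by linarith) hkT
        fun z s hz hs hs' =>
          ⟨ha z s hz hs hs', (hq z s ((tk0 k).trans_lt hs) (hs'.trans hkT)).2⟩).1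
      rw [add_sub_cancel_left] at hS1
      have hkT' := tkT k (by omega)
      have l1 := euler_step_mono hν hνM (i x) (hvM k (by omega) x).2
        (hY (x + h) _ (tk0 k) hkT') (i (x + h)) (hY (x - h) _ (tk0 k) hkT') (i (x - h))
      rw [hvs, tks]
      linarith
  obtain ⟨B, hBd, hBb⟩ := scheme_error (N := N) (M := M₂) (β := fun k => β (k * τ)) (v := v)
    (U := fun k x => U x (k * τ)) (J := fun k x => J x (k * τ)) (S := fun k x => S x (k * τ))
    (e := fun k => if (k * τ : ℝ) < t₁ then M ^ 2 else δ)
    (E := fun k => M ^ 2 * min (k * τ) (t₁ + τ) + δ * (k * τ))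
    hh hμ hτ hM₂0.le hμM (fun k _ => hβ _ (tk0 k)) (fun k x hk => hvM k hk x)
    (fun k x hk => ⟨(hU01 x _ (tk0 k) (tkT k hk)).1,
      (hU01 x _ (tk0 k) (tkT k hk)).2.trans hMM₂⟩)
    (fun x => by simp [hv0]) (fun x => by simp [hJ0]) (fun x => by simp [hS0])
    hvs (fun k x hk => by
      simpa using hUeq x (k * τ) (tk0 k) (tkT k hk))
    (fun k => by
      split_ifs
      · positivity
      · exact hδ0.le)
    (fun k => by
      have := tk0 k
      positivity)
    (fun k => by
      rw [tks]
      split_ifs with hk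
      · rw [min_eq_left (by linarith), min_eq_left (by linarith)]
        linarith [mul_nonneg hδ0.le hτ0.le]
      · have : min (k * τ) (t₁ + τ) ≤ min (k * τ + τ) (t₁ + τ) :=
          min_le_min_right _ (by linarith)
        have := mul_le_mul_of_nonneg_left this (sq_nonneg M)
        linarith)
    (fun k x hk => by
      have h1 := tkT (k + 1) hk
      rw [tks] at h1
      have := hcons h hh hmD U J hU hJ x (k * τ) (tk0 k) h1
      rw [tks]
      exact this)
  have hNT : (N : ℝ) * τ = T := hN
  simp only [hNT] at hBd hBb
  have hbig : ∀ x, |x - x₀| ≤ r → η * h ^ 2 ≤ B (x + h) - 2 * B x + B (x - h) := by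
    intro x hx
    have a1 : Y x₀ T - η ≤ Y x T := by
      have := hYr x (by rw [Real.dist_eq]; linarith)
      rw [Real.dist_eq, abs_lt] at this
      linarith [this.1]
    have a2 : U x T ≤ y x₀ T + η := by
      refine (hU x T 0 (y x₀ T + η) hT.le le_rfl fun z hz => ?_).2
      have h1 : |z - x₀| ≤ |z - x| + |x - x₀| := abs_sub_le z x x₀
      have := hyr z (by rw [Real.dist_eq]; linarith)
      rw [Real.dist_eq, abs_lt] at this
      exact ⟨(hy z T hT.le le_rfl).1, by linarith [this.2]⟩
    have a3 := hvY N le_rfl x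
    rw [hNT] at a3
    have a4 := hBd x
    rw [eq_div_iff (by positivity)] at a4
    rw [← a4]
    refine mul_le_mul_of_nonneg_right ?_ (sq_nonneg h)
    linarith
  obtain ⟨L, hL1, hL2⟩ : ∃ L : ℕ, (L : ℝ) * h ≤ r ∧ r / 2 ≤ L * h := by
    refine ⟨⌊r / h⌋₊, ?_, ?_⟩
    · rw [← le_div_iff₀ hh]
      exact Nat.floor_le (by positivity)
    · have := Nat.lt_floor_add_one (r / h)
      rw [div_lt_iff₀ hh] at this
      linarith
  have grow := quadratic_growth hh hbig L hL1
  have hLh : (0:ℝ) ≤ L * h := by positivity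
  have Bs : ∀ x, |x| ≤ |x₀| + r → |B x| ≤ ex * ω * W := by
    intro x hx
    refine (hBb x).trans ?_
    have c1 : M ^ 2 * min T (t₁ + τ) + δ * T ≤ ω := by
      have d1 : M ^ 2 * min T (t₁ + τ) ≤ M ^ 2 * (2 * t₁) :=
        mul_le_mul_of_nonneg_left ((min_le_right _ _).trans (by linarith)) (sq_nonneg M)
      have d2 : M ^ 2 * (2 * t₁) = ω / 2 := by rw [ht₁]; field_simp; ring
      have d3 : δ * T = ω / 2 := by rw [hδ]; field_simp
      linarith
    have c2 : 1 + x ^ 2 ≤ W := by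
      rw [hW, ← sq_abs x]
      have := pow_le_pow_left₀ (abs_nonneg x) hx 2
      linarith
    exact mul_le_mul (mul_le_mul_of_nonneg_left c1 hex0.le) c2 (by positivity) (by positivity)
  have e1 := Bs (x₀ + L * h) ((abs_add_le _ _).trans (by rw [abs_of_nonneg hLh]; linarith))
  have e2 := Bs (x₀ - L * h) ((abs_sub _ _).trans (by rw [abs_of_nonneg hLh]; linarith))
  have e3 := Bs x₀ (by linarith)
  have e4 : ex * ω * W = η * r ^ 2 / 17 := by rw [hω]; field_simp
  rw [e4] at e1 e2 e3
  rw [abs_le] at e1 e2 e3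
  have e5 : η * (r / 2) ^ 2 ≤ η * (L * h) ^ 2 :=
    mul_le_mul_of_nonneg_left (pow_le_pow_left₀ (by positivity) hL2 2) hη0.le
  have e6 : 0 < η * r ^ 2 := by positivity
  linarith [e1.2, e2.2, e3.1]

lemma CondF2.exponent_eq_two {m c l θ : ℝ} {f : ℝ → ℝ → ℝ} {κ φ : ℝ → ℝ} (hm : 1 < m)
    (h1 : CondF1 f κ θ) (h2 : CondF2 m f κ c l φ) : m = 2 := by
  obtain ⟨hc, hl, hφ, -, hφl, hφp, hda, hineq⟩ := h2
  have hf0 := h1.2.2.2.2.1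
  set I := Icc (-l) l with hI
  have hlI : l ∈ I := ⟨by linarith, le_rfl⟩
  have hud : UniqueDiffOn ℝ I := uniqueDiffOn_Icc (by linarith)
  have hdiff : ∀ z ∈ I, HasDerivWithinAt φ (derivWithin φ I z) I z := fun z hz =>
    ((hφ.differentiableOn (by norm_num)) z hz).hasDerivWithinAt
  have hφ'c : ContinuousOn (derivWithin φ I) I :=
    hφ.continuousOn_derivWithin hud (by norm_num)
  set a := derivWithin φ I l with ha
  have ha0 : a < 0 := by linarith
  set ψ := derivWithin (fun w => φ w ^ m) I with hψ
  have hψeq : ∀ z ∈ I, ψ z = derivWithin φ I z * m * φ z ^ (m - 1) := fun z hz =>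
    ((hdiff z hz).rpow_const (Or.inr hm.le)).derivWithin (hud z hz)
  have hD := hineq 0 l hlI
  rw [hφl, hf0, zero_mul, add_zero] at hD
  set D := derivWithin ψ I l with hDdef
  have hD0 : 0 < D := by nlinarith
  have hψd : HasDerivWithinAt ψ D I l := by
    by_contra hcon
    have : ¬ DifferentiableWithinAt ℝ ψ I l := fun h => hcon h.hasDerivWithinAt
    rw [hDdef, derivWithin_zero_of_not_differentiableWithinAt this] at hD0
    exact lt_irrefl _ hD0
  have hψl : ψ l = 0 := by
    rw [hψeq l hlI, hφl, Real.zero_rpow (by linarith), mul_zero]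
  have hev : ∀ᶠ s in nhdsWithin (0:ℝ) (Ioi 0), 0 < s ∧ s < 2 * l := by
    have : Ioo (0:ℝ) (2 * l) ∈ nhdsWithin (0:ℝ) (Ioi 0) := Ioo_mem_nhdsGT (by linarith)
    exact this
  have ht0 : Tendsto (fun s : ℝ => l - s) (nhdsWithin 0 (Ioi 0)) (nhds l) := by
    have : Tendsto (fun s : ℝ => l - s) (nhds 0) (nhds (l - 0)) :=
      (continuous_const.sub continuous_id).tendsto 0
    rw [sub_zero] at this
    exact this.mono_left nhdsWithin_le_nhds
  have htI : Tendsto (fun s : ℝ => l - s) (nhdsWithin 0 (Ioi 0)) (nhdsWithin l I) := by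
    refine tendsto_nhdsWithin_iff.2 ⟨ht0, ?_⟩
    filter_upwards [hev] with s hs
    exact ⟨by linarith [hs.2], by linarith [hs.1]⟩
  have htI' : Tendsto (fun s : ℝ => l - s) (nhdsWithin 0 (Ioi 0)) (nhdsWithin l (I \ {l})) := by
    refine tendsto_nhdsWithin_iff.2 ⟨ht0, ?_⟩
    filter_upwards [hev] with s hs
    refine ⟨⟨by linarith [hs.2], by linarith [hs.1]⟩, ?_⟩
    simp only [mem_singleton_iff]
    linarith [hs.1]
  have s1 : Tendsto (fun s => φ (l - s) / s) (nhdsWithin 0 (Ioi 0)) (nhds (-a)) := by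
    have := ((hasDerivWithinAt_iff_tendsto_slope.1 (hdiff l hlI)).comp htI').neg
    refine this.congr' ?_
    filter_upwards [hev] with s hs
    simp only [Function.comp, slope_def_field, hφl]
    rw [show l - s - l = -s by ring, sub_zero, div_neg, neg_neg]
  have s2 : Tendsto (fun s => -(ψ (l - s) / s)) (nhdsWithin 0 (Ioi 0)) (nhds D) := by
    have := (hasDerivWithinAt_iff_tendsto_slope.1 hψd).comp htI'
    refine this.congr' ?_
    filter_upwards [hev] with s hs
    simp only [Function.comp, slope_def_field, hψl]
    rw [show l - s - l = -s by ring, sub_zero, div_neg]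
  have s3 : Tendsto (fun s => derivWithin φ I (l - s)) (nhdsWithin 0 (Ioi 0)) (nhds a) :=
    (hφ'c l hlI).tendsto.comp htI
  have s4 : Tendsto (fun s => -(derivWithin φ I (l - s)) * m * (φ (l - s) / s) ^ (m - 1))
      (nhdsWithin 0 (Ioi 0)) (nhds (-a * m * (-a) ^ (m - 1))) :=
    (s3.neg.mul_const m).mul (s1.rpow_const (Or.inr (by linarith)))
  have hE : 0 < -a * m * (-a) ^ (m - 1) :=
    mul_pos (mul_pos (by linarith) (by linarith)) (Real.rpow_pos_of_pos (by linarith) _)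
  set L := D / (-a * m * (-a) ^ (m - 1)) with hL
  have hL0 : 0 < L := div_pos hD0 hE
  have s5 : Tendsto (fun s : ℝ => s ^ (m - 2)) (nhdsWithin 0 (Ioi 0)) (nhds L) := by
    refine (s2.div s4 hE.ne').congr' ?_
    have hpos := s4.eventually (lt_mem_nhds hE)
    filter_upwards [hev, hpos] with s hs hp
    have hz : l - s ∈ I := ⟨by linarith [hs.2], by linarith [hs.1]⟩
    have hφz : 0 < φ (l - s) := hφp _ ⟨by linarith [hs.2], by linarith [hs.1]⟩
    rw [Pi.div_apply, div_eq_iff hp.ne', hψeq _ hz, Real.div_rpow hφz.le hs.1.le,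
      show m - 1 = (m - 2) + 1 by ring, Real.rpow_add hs.1, Real.rpow_one]
    have := Real.rpow_pos_of_pos hs.1 (m - 2)
    field_simp
  have hzero : ∀ e : ℝ, 0 < e →
      Tendsto (fun s : ℝ => s ^ e) (nhdsWithin 0 (Ioi 0)) (nhds 0) := by
    intro e he
    have := (Real.continuousAt_rpow_const 0 e (Or.inr he.le)).tendsto
    rw [Real.zero_rpow he.ne'] at this
    exact this.mono_left nhdsWithin_le_nhds
  rcases lt_trichotomy m 2 with hlt | heq | hgt
  · exfalso
    have h := s5.mul (hzero (2 - m) (by linarith))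
    have h' : Tendsto (fun _ : ℝ => (1:ℝ)) (nhdsWithin 0 (Ioi 0)) (nhds (L * 0)) := by
      refine h.congr' ?_
      filter_upwards [hev] with s hs
      rw [← Real.rpow_add hs.1]
      simp
    have := tendsto_nhds_unique h' tendsto_const_nhds
    simp at this
  · exact heq
  · exfalso
    have := tendsto_nhds_unique s5 (hzero (m - 2) (by linarith))
    linarith

/-- The reaction term is Lipschitz for bounded densities, uniformly in space. -/
lemma CondF1.source_lipschitz {f : ℝ → ℝ → ℝ} {κ : ℝ → ℝ} {θ : ℝ} (h1 : CondF1 f κ θ) (M : ℝ) :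
    ∃ Λ : ℝ, 0 < Λ ∧ ∀ x y a b, |x - y| ≤ 1 → a ∈ Icc 0 M → b ∈ Icc 0 M →
      |f x a * (κ x - a) - f y b * (κ y - b)| ≤ Λ * (|x - y| + |a - b|) := by
  obtain ⟨hf, hκ, hfp, hκp, -⟩ := h1
  set F : ℝ × ℝ → ℝ := fun p => f p.1 p.2 * (κ p.1 - p.2) with hF
  have hFc : ContDiff ℝ 1 F := by
    have e1 : ContDiff ℝ 1 fun p : ℝ × ℝ => f p.1 p.2 := hf.of_le (by norm_num)
    have e2 : ContDiff ℝ 1 fun p : ℝ × ℝ => κ p.1 :=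
      (hκ.of_le (by norm_num)).comp contDiff_fst
    exact e1.mul (e2.sub contDiff_snd)
  have hcpt : IsCompact (Icc (-1:ℝ) 2 ×ˢ Icc 0 M) := isCompact_Icc.prod isCompact_Icc
  obtain ⟨K, hK⟩ := (hFc.locallyLipschitz.locallyLipschitzOn
    (s := Icc (-1:ℝ) 2 ×ˢ Icc 0 M)).exists_lipschitzOnWith_of_compact hcpt
  refine ⟨K + 1, by positivity, fun x y a b hxy ha hb => ?_⟩
  have hper : ∀ a, Function.Periodic (fun x => f x a * (κ x - a)) 1 := fun a x => by
    simp only [hfp, hκp]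
  have e1 := (hper a).sub_zsmul_eq ⌊x⌋ (x := x)
  have e2 := (hper b).sub_zsmul_eq ⌊x⌋ (x := y)
  simp only [zsmul_eq_mul, mul_one] at e1 e2
  rw [← e1, ← e2]
  have hx0 := Int.floor_le x
  have hx1 := Int.lt_floor_add_one x
  have hxy' := abs_le.1 hxy
  have := hK.dist_le_mul (x - ⌊x⌋, a) ⟨⟨by linarith, by linarith⟩, ha⟩
    (y - ⌊x⌋, b) ⟨⟨by linarith [hxy'.2], by linarith [hxy'.1]⟩, hb⟩
  rw [Prod.dist_eq, Real.dist_eq, Real.dist_eq, Real.dist_eq] at this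
  simp only [sub_sub_sub_cancel_right] at this
  refine this.trans ?_
  refine mul_le_mul (by linarith) ?_ (le_max_of_le_left (abs_nonneg _)) (by positivity)
  exact max_le (by linarith [abs_nonneg (a - b)]) (by linarith [abs_nonneg (x - y)])

/-- For `m = 2`, the derivatives of the profile, its differential inequality, and the resulting
lower bound `φ'² + c φ' ≥ -C φ`. -/
lemma CondF2.profile_bounds {f : ℝ → ℝ → ℝ} {κ φ : ℝ → ℝ} {θ c l : ℝ}
    (h1 : CondF1 f κ θ) (h2 : CondF2 2 f κ c l φ) :
    ∃ φ1 φ2 : ℝ → ℝ, ContinuousOn φ1 (Icc (-l) l) ∧ ContinuousOn φ2 (Icc (-l) l) ∧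
      (∀ z ∈ Ioo (-l) l, HasDerivAt φ (φ1 z) z) ∧
      (∀ z ∈ Ioo (-l) l, HasDerivAt φ1 (φ2 z) z) ∧
      (∀ y, ∀ z ∈ Ioo (-l) l, 0 ≤ 2 * φ z * φ2 z + 2 * φ1 z ^ 2 + c * φ1 z
        + f y (φ z) * (κ y - φ z)) ∧
      ∃ C₁ : ℝ, 0 ≤ C₁ ∧ ∀ z ∈ Ioo (-l) l, -(C₁ * φ z) ≤ φ1 z ^ 2 + c * φ1 z := by
  obtain ⟨hc, hl, hφ, hφl', hφl, hφp, hda, hineq⟩ := h2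
  have hf0 := h1.2.2.2.2.1
  set I := Icc (-l) l with hI
  have hud : UniqueDiffOn ℝ I := uniqueDiffOn_Icc (by linarith)
  have hlI : l ∈ I := ⟨by linarith, le_rfl⟩
  have hlI' : -l ∈ I := ⟨le_rfl, by linarith⟩
  have hdiff : ∀ z ∈ I, HasDerivWithinAt φ (derivWithin φ I z) I z := fun z hz =>
    ((hφ.differentiableOn (by norm_num)) z hz).hasDerivWithinAt
  have hφ1 : ContDiffOn ℝ 1 (derivWithin φ I) I := hφ.derivWithin hud (by norm_num)
  set φ1 := derivWithin φ I with hφ1def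
  have hdiff1 : ∀ z ∈ I, HasDerivWithinAt φ1 (derivWithin φ1 I z) I z := fun z hz =>
    ((hφ1.differentiableOn (by norm_num)) z hz).hasDerivWithinAt
  have hφ2 : ContinuousOn (derivWithin φ1 I) I := hφ1.continuousOn_derivWithin hud le_rfl
  set φ2 := derivWithin φ1 I with hφ2def
  have hnhds : ∀ z ∈ Ioo (-l) l, I ∈ nhds z := fun z hz => Icc_mem_nhds hz.1 hz.2
  have hψ : ∀ z ∈ I, derivWithin (fun w => φ w ^ (2:ℝ)) I z = 2 * φ z * φ1 z := by
    intro z hz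
    have h : HasDerivWithinAt (fun w => φ w ^ 2) (2 * φ z * φ1 z) I z :=
      ((hdiff z hz).pow 2).congr_deriv (by simp)
    simp only [Real.rpow_two]
    exact h.derivWithin (hud z hz)
  have hψ' : ∀ z ∈ I, derivWithin (derivWithin (fun w => φ w ^ (2:ℝ)) I) I z
      = 2 * φ z * φ2 z + 2 * φ1 z ^ 2 := by
    intro z hz
    rw [derivWithin_congr hψ (hψ z hz)]
    have h : HasDerivWithinAt (fun w => 2 * φ w * φ1 w) (2 * φ1 z * φ1 z + 2 * φ z * φ2 z) I z :=
      ((hdiff z hz).const_mul 2).mul (hdiff1 z hz)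
    rw [h.derivWithin (hud z hz)]
    ring
  have hB : ∀ y, ∀ z ∈ I, 0 ≤ 2 * φ z * φ2 z + 2 * φ1 z ^ 2 + c * φ1 z
      + f y (φ z) * (κ y - φ z) := by
    intro y z hz
    have := hineq y z hz
    rwa [hψ' z hz] at this
  refine ⟨φ1, φ2, hφ1.continuousOn, hφ2, fun z hz => (hdiff z (Ioo_subset_Icc_self hz)).hasDerivAt
    (hnhds z hz), fun z hz => (hdiff1 z (Ioo_subset_Icc_self hz)).hasDerivAt (hnhds z hz),
    fun y z hz => hB y z (Ioo_subset_Icc_self hz), ?_⟩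
  have hφ0 : ∀ z ∈ I, 0 ≤ φ z := by
    intro z hz
    rcases hz.1.eq_or_lt with h | h
    · rw [← h, hφl']
    rcases hz.2.eq_or_lt with h' | h'
    · rw [h', hφl]
    · exact (hφp z ⟨h, h'⟩).le
  obtain ⟨Mφ, hMφ⟩ := isCompact_Icc.exists_bound_of_continuousOn hφ.continuousOn
  obtain ⟨M2, hM2⟩ := isCompact_Icc.exists_bound_of_continuousOn hφ2
  obtain ⟨Λ, hΛ, hLip⟩ := h1.source_lipschitz Mφ
  have hM20 : 0 ≤ M2 := (norm_nonneg _).trans (hM2 l hlI)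
  have hMφ0 : 0 ≤ Mφ := (norm_nonneg _).trans (hMφ l hlI)
  -- away from zero on the set where the slope is in the critical range
  set A : Set ℝ := {z ∈ I | φ1 z ∈ Icc (-c) (-c / 4)} with hA
  have hAc : IsCompact A :=
    isCompact_Icc.of_isClosed_subset (hφ1.continuousOn.preimage_isClosed_of_isClosed isClosed_Icc
      isClosed_Icc) fun z hz => hz.1
  have hslope : 0 ≤ φ1 (-l) := by
    have h := hasDerivWithinAt_iff_tendsto_slope.1 (hdiff (-l) hlI')
    have : (nhdsWithin (-l) (I \ {-l})).NeBot := by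
      have e : I \ {-l} = Ioc (-l) l := Icc_sdiff_left
      rw [e]
      exact left_nhdsWithin_Ioc_neBot (by linarith)
    refine ge_of_tendsto h ?_
    filter_upwards [self_mem_nhdsWithin] with z hz
    rw [slope_def_field, hφl', sub_zero]
    exact div_nonneg (hφ0 z hz.1) (by linarith [hz.1.1])
  obtain ⟨δ₀, hδ₀, hAδ⟩ : ∃ δ₀ > 0, ∀ z ∈ A, δ₀ ≤ φ z := by
    rcases A.eq_empty_or_nonempty with he | hne
    · exact ⟨1, one_pos, fun z hz => by rw [he] at hz; exact hz.elim⟩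
    obtain ⟨z₀, hz₀, hmin⟩ := hAc.exists_isMinOn hne
      (hφ.continuousOn.mono fun z hz => hz.1)
    refine ⟨φ z₀, hφp z₀ ⟨lt_of_le_of_ne hz₀.1.1 ?_, lt_of_le_of_ne hz₀.1.2 ?_⟩,
      fun z hz => hmin hz⟩
    · rintro rfl
      linarith [hz₀.2.2]
    · rintro rfl
      linarith [hz₀.2.1]
  refine ⟨2 * (2 * M2 + Λ) + c ^ 2 / δ₀, by positivity, ?_⟩
  intro z hz
  have hzI := Ioo_subset_Icc_self hz
  have hφz := hφp z hz
  have hp1 : 0 ≤ 2 * (2 * M2 + Λ) * φ z := by positivity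
  have hp2 : 0 ≤ c ^ 2 / δ₀ * φ z := by positivity
  rw [add_mul]
  rcases le_total 0 (φ1 z) with h | h
  · nlinarith [mul_nonneg hc.le h]
  rcases le_total (φ1 z) (-c) with h' | h'
  · nlinarith
  rcases le_total (φ1 z) (-c / 4) with h'' | h''
  · have h3 := hAδ z ⟨hzI, h', h''⟩
    have h4 : c ^ 2 ≤ c ^ 2 / δ₀ * φ z := by
      rw [div_mul_eq_mul_div, le_div_iff₀ hδ₀]
      exact mul_le_mul_of_nonneg_left h3 (sq_nonneg c)
    nlinarith
  · have hBz := hB 0 z hzI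
    have hG : f 0 (φ z) * (κ 0 - φ z) ≤ Λ * φ z := by
      have := hLip 0 0 (φ z) 0 (by simp) ⟨hφz.le, (le_abs_self _).trans (hMφ z hzI)⟩
        ⟨le_rfl, hMφ0⟩
      rw [hf0] at this
      simp only [zero_mul, sub_zero, sub_self, abs_zero, zero_add, abs_of_pos hφz] at this
      exact (le_abs_self _).trans this
    have h5 : 2 * φ z * φ2 z ≤ 2 * φ z * M2 :=
      mul_le_mul_of_nonneg_left ((le_abs_self _).trans (hM2 z hzI)) (by linarith)
    have h6 : -((2 * M2 + Λ) * φ z) ≤ φ1 z * (c + 2 * φ1 z) := by nlinarith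
    have h7 : c / 2 ≤ c + 2 * φ1 z := by linarith
    nlinarith [sq_nonneg (φ1 z), mul_nonneg (neg_nonneg.2 h) (by linarith : 0 ≤ 2 * φ1 z + c - c/2)]

/-- A lower bound on the second derivative of `V²` bounds its second differences. -/
lemma le_second_difference_sq {V V1 V2 : ℝ → ℝ} {x h k : ℝ} (hh : 0 < h)
    (hV : ∀ y ∈ Icc (x - h) (x + h), HasDerivAt V (V1 y) y)
    (hV1 : ∀ y ∈ Icc (x - h) (x + h), HasDerivAt V1 (V2 y) y)
    (hk : ∀ y ∈ Icc (x - h) (x + h), k ≤ 2 * (V y * V2 y) + 2 * V1 y ^ 2) :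
    k * h ^ 2 ≤ V (x + h) ^ 2 + V (x - h) ^ 2 - 2 * V x ^ 2 := by
  set F : ℝ → ℝ := fun y => V y ^ 2 - k / 2 * y ^ 2 with hF
  set F1 : ℝ → ℝ := fun y => 2 * V y * V1 y - k * y with hF1
  have hFd : ∀ y ∈ Icc (x - h) (x + h), HasDerivAt F (F1 y) y := fun y hy =>
    (((hV y hy).pow 2).sub ((hasDerivAt_pow 2 y).const_mul (k / 2))).congr_deriv (by
      simp only [hF1]; push_cast; ring)
  have hF1d : ∀ y ∈ Icc (x - h) (x + h),
      HasDerivAt F1 (2 * (V y * V2 y) + 2 * V1 y ^ 2 - k) y := fun y hy =>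
    ((((hV y hy).const_mul 2).mul (hV1 y hy)).sub ((hasDerivAt_id y).const_mul k)).congr_deriv
      (by ring)
  have hconv : ConvexOn ℝ (Icc (x - h) (x + h)) F := by
    refine convexOn_of_hasDerivWithinAt2_nonneg (convex_Icc _ _)
      (fun y hy => (hFd y hy).continuousAt.continuousWithinAt)
      (fun y hy => (hFd y (interior_subset hy)).hasDerivWithinAt)
      (fun y hy => (hF1d y (interior_subset hy)).hasDerivWithinAt)
      (fun y hy => sub_nonneg.2 (hk y (interior_subset hy)))
  have := hconv.2 (show x - h ∈ Icc (x - h) (x + h) from ⟨le_rfl, by linarith⟩)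
    (show x + h ∈ Icc (x - h) (x + h) from ⟨by linarith, le_rfl⟩)
    (by norm_num : (0:ℝ) ≤ 1 / 2) (by norm_num : (0:ℝ) ≤ 1 / 2) (by norm_num)
  simp only [smul_eq_mul] at this
  rw [show 1 / 2 * (x - h) + 1 / 2 * (x + h) = x by ring] at this
  simp only [hF] at this
  linarith

lemma sq_sub_le_max_sq {a e v : ℝ} (ha : 0 ≤ a) (he : 0 ≤ e) (h : a - e ≤ v) :
    a ^ 2 - 2 * a * e ≤ max v 0 ^ 2 := by
  rcases le_total e a with h1 | h1
  · have := pow_le_pow_left₀ (sub_nonneg.2 h1) (h.trans (le_max_left v 0)) 2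
    nlinarith [sq_nonneg e]
  · have := mul_le_mul_of_nonneg_left h1 ha
    have := mul_nonneg ha he
    linarith [sq_nonneg (max v 0)]

lemma le_second_difference_sq_max_of_nonneg {d h s L ω v₁ v₂ : ℝ} (hh : 0 < h)
    (hs : 0 ≤ s) (hsL : s ≤ L) (hω : 0 ≤ ω) (hd0 : 0 ≤ d) (hd : d ≤ L * h)
    (h₁ : d + s * h - 2 * (ω * h) ≤ v₁) (h₂ : d - s * h - 2 * (ω * h) ≤ v₂) :
    (s ^ 2 - 8 * L * ω) * h ^ 2 ≤ max v₁ 0 ^ 2 + max v₂ 0 ^ 2 - 2 * d ^ 2 := by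
  have hωh : 0 ≤ ω * h := by positivity
  have hsh : 0 ≤ s * h := by positivity
  have e₁ := sq_sub_le_max_sq (add_nonneg hd0 hsh) (by positivity : 0 ≤ 2 * (ω * h)) h₁
  have p1 : d * (ω * h) ≤ L * h * (ω * h) := mul_le_mul_of_nonneg_right hd hωh
  have p2 : s * h * (ω * h) ≤ L * h * (ω * h) :=
    mul_le_mul_of_nonneg_right (mul_le_mul_of_nonneg_right hsL hh.le) hωh
  rcases le_total (s * h) d with h3 | h3
  · have e₂ := sq_sub_le_max_sq (sub_nonneg.2 h3) (by positivity : 0 ≤ 2 * (ω * h)) h₂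
    nlinarith [sq_nonneg (s * h)]
  · have p3 : d * d ≤ d * (s * h) := mul_le_mul_of_nonneg_left h3 hd0
    have p4 : 0 ≤ d * (s * h) := by positivity
    nlinarith [sq_nonneg (max v₂ 0)]

/-- Near the edge of the support, second differences of the square of the positive part are
controlled by the slope alone. -/
lemma le_second_difference_sq_max {V V1 : ℝ → ℝ} {x h L ω : ℝ} (hh : 0 < h)
    (hV : ∀ y ∈ Icc (x - h) (x + h), HasDerivAt V (V1 y) y)
    (hω : ∀ y ∈ Icc (x - h) (x + h), |V1 y - V1 x| ≤ ω) (hL : |V1 x| ≤ L)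
    (hx : V x ≤ L * h) (hx' : -(ω * h) ≤ V x) :
    (V1 x ^ 2 - 8 * L * ω) * h ^ 2
      ≤ max (V (x + h)) 0 ^ 2 + max (V (x - h)) 0 ^ 2 - 2 * max (V x) 0 ^ 2 := by
  have hω0 : 0 ≤ ω := (abs_nonneg _).trans (hω x ⟨by linarith, by linarith⟩)
  have hL0 : 0 ≤ L := (abs_nonneg _).trans hL
  have hd : max (V x) 0 ≤ V x + ω * h := max_le (by nlinarith) (by linarith)
  have hr : V x + V1 x * h - ω * h ≤ V (x + h) := by
    obtain ⟨y, hy, hy'⟩ := exists_hasDerivAt_eq_slope V V1 (by linarith : x < x + h)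
      (fun y hy => (hV y ⟨by linarith [hy.1], hy.2⟩).continuousAt.continuousWithinAt)
      (fun y hy => hV y ⟨by linarith [hy.1], hy.2.le⟩)
    rw [add_sub_cancel_left, eq_div_iff hh.ne'] at hy'
    have := (abs_le.1 (hω y ⟨by linarith [hy.1], hy.2.le⟩)).1
    nlinarith
  have hl : V x - V1 x * h - ω * h ≤ V (x - h) := by
    obtain ⟨y, hy, hy'⟩ := exists_hasDerivAt_eq_slope V V1 (by linarith : x - h < x)
      (fun y hy => (hV y ⟨hy.1, by linarith [hy.2]⟩).continuousAt.continuousWithinAt)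
      (fun y hy => hV y ⟨hy.1.le, by linarith [hy.2]⟩)
    rw [sub_sub_cancel, eq_div_iff hh.ne'] at hy'
    have := (abs_le.1 (hω y ⟨hy.1.le, by linarith [hy.2]⟩)).2
    nlinarith
  have hdL : max (V x) 0 ≤ L * h := max_le hx (by positivity)
  rcases le_total 0 (V1 x) with hs | hs
  · exact le_second_difference_sq_max_of_nonneg hh hs ((le_abs_self _).trans hL) hω0
      (le_max_right _ _) hdL (by linarith) (by linarith)
  · have := le_second_difference_sq_max_of_nonneg (s := -V1 x) hh (neg_nonneg.2 hs)
      ((neg_le_abs _).trans hL) hω0 (le_max_right _ _) hdL (v₁ := V (x - h)) (v₂ := V (x + h))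
      (by linarith) (by linarith)
    rw [neg_sq] at this
    linarith

/-- Projection of the real line onto `[-l, l]`. -/
def clamp (l z : ℝ) : ℝ := max (-l) (min l z)

lemma clamp_mem {l : ℝ} (hl : 0 < l) (z : ℝ) : clamp l z ∈ Icc (-l) l :=
  ⟨le_max_left _ _, max_le (by linarith) (min_le_left _ _)⟩

lemma clamp_of_mem {l z : ℝ} (hz : z ∈ Icc (-l) l) : clamp l z = z := by
  rw [clamp, min_eq_right hz.2, max_eq_right hz.1]

lemma mem_of_clamp_mem {l z : ℝ} (h : clamp l z ∈ Ioo (-l) l) : z ∈ Ioo (-l) l := by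
  obtain ⟨h1, h2⟩ := h
  rw [clamp] at h1 h2
  have h3 := (lt_max_iff.1 h1).resolve_left (lt_irrefl _)
  refine ⟨(lt_min_iff.1 h3).2, ?_⟩
  exact (min_lt_iff.1 (max_lt_iff.1 h2).2).resolve_left (lt_irrefl _)

lemma abs_clamp_sub_le (l z w : ℝ) : |clamp l z - clamp l w| ≤ |z - w| := by
  unfold clamp
  refine (abs_max_sub_max_le_max _ _ _ _).trans ?_
  rw [sub_self, abs_zero]
  refine max_le (abs_nonneg _) ((abs_min_sub_min_le_max _ _ _ _).trans ?_)
  rw [sub_self, abs_zero]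
  exact max_le (abs_nonneg _) le_rfl

lemma continuous_clamp (l : ℝ) : Continuous (clamp l) := by
  unfold clamp
  fun_prop

/-- Uniform modulus of continuity on parabolic stencils in the moving frame. -/
lemma exists_stencil_modulus {l T μ ω k : ℝ} {F : ℝ × ℝ → ℝ} {σ : ℝ → ℝ} (hl : 0 < l)
    (hμ : 0 < μ) (hω : 0 < ω) (hk : 0 ≤ k) (hF : ContinuousOn F (Icc (-l) l ×ˢ Icc 0 T))
    (hσ : ∀ s ∈ Icc 0 T, ∀ t ∈ Icc 0 T, |σ s - σ t| ≤ k * |s - t|) :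
    ∃ h₀ > 0, ∀ h, 0 < h → h < h₀ → ∀ x x' t t', |x' - x| ≤ 2 * h → t ∈ Icc 0 T → t' ∈ Icc 0 T →
      |t' - t| ≤ μ * h ^ 2 → |F (clamp l (x' - σ t'), t') - F (clamp l (x - σ t), t)| ≤ ω := by
  have huc := (isCompact_Icc.prod isCompact_Icc).uniformContinuousOn_of_continuous hF
  obtain ⟨δ, hδ, hd⟩ := Metric.uniformContinuousOn_iff.1 huc ω hω
  refine ⟨min 1 (δ / (2 + k * μ + μ)), by positivity, fun h h0 h1 x x' t t' hx ht ht' htt => ?_⟩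
  have h2 := h1.trans_le (min_le_left _ _)
  have h3 := h1.trans_le (min_le_right _ _)
  rw [lt_div_iff₀ (by positivity)] at h3
  have hsq : μ * h ^ 2 ≤ μ * h := by
    refine mul_le_mul_of_nonneg_left ?_ hμ.le
    nlinarith
  have h4 : |(x' - σ t') - (x - σ t)| ≤ 2 * h + k * (μ * h) := by
    have e : (x' - σ t') - (x - σ t) = (x' - x) - (σ t' - σ t) := by ring
    rw [e]
    refine (abs_sub _ _).trans (add_le_add hx ((hσ t' ht' t ht).trans ?_))
    exact mul_le_mul_of_nonneg_left (htt.trans hsq) hk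
  have hkm : 0 ≤ k * μ * h := by positivity
  have hm : 0 < μ * h := by positivity
  refine (hd _ ⟨clamp_mem hl _, ht'⟩ _ ⟨clamp_mem hl _, ht⟩ ?_).le
  rw [Prod.dist_eq, Real.dist_eq, Real.dist_eq]
  refine max_lt ((abs_clamp_sub_le _ _ _).trans_lt ?_) ?_
  · linarith
  · simp only
    linarith

/-- A strict travelling subsolution in the moving frame satisfies the discrete inequality of the
explicit finite-difference scheme on all small stencils. -/
lemma exists_discrete_subsolution {l T lam μ Λ C k : ℝ} {V V1 V2 N : ℝ × ℝ → ℝ}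
    {r : ℝ → ℝ × ℝ → ℝ} {σ : ℝ → ℝ} {W : ℝ → ℝ → ℝ} (hl : 0 < l) (hT : 0 ≤ T)
    (hlam : 0 < lam) (hμ : 0 < μ) (hΛ : 0 < Λ) (hC : 0 ≤ C) (hk : 0 ≤ k)
    (hVc : ContinuousOn V (Icc (-l) l ×ˢ Icc 0 T)) (hV1c : ContinuousOn V1 (Icc (-l) l ×ˢ Icc 0 T))
    (hV2c : ContinuousOn V2 (Icc (-l) l ×ˢ Icc 0 T)) (hNc : ContinuousOn N (Icc (-l) l ×ˢ Icc 0 T))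
    (hσ : ∀ s ∈ Icc 0 T, ∀ t ∈ Icc 0 T, |σ s - σ t| ≤ k * |s - t|)
    (hVμ : ∀ q ∈ Icc (-l) l ×ˢ Icc 0 T, 2 * μ * V q ≤ 1)
    (hpos : ∀ q ∈ Icc (-l) l ×ˢ Icc 0 T, -lam < V q → q.1 ∈ Ioo (-l) l)
    (hV : ∀ t ∈ Icc 0 T, ∀ z ∈ Ioo (-l) l, HasDerivAt (fun z => V (z, t)) (V1 (z, t)) z)
    (hV1 : ∀ t ∈ Icc 0 T, ∀ z ∈ Ioo (-l) l, HasDerivAt (fun z => V1 (z, t)) (V2 (z, t)) z)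
    (hN : ∀ x, ∀ t ∈ Icc 0 T, x - σ t ∈ Ioo (-l) l →
      HasDerivAt (fun s => V (x - σ s, s)) (N (x - σ t, t)) t)
    (hP1 : ∀ x, ∀ q ∈ Icc (-l) l ×ˢ Icc 0 T, q.1 ∈ Ioo (-l) l → 0 ≤ V q →
      N q + Λ * V q + lam ≤ 2 * (V q * V2 q) + 2 * V1 q ^ 2 + r x q)
    (hP2 : ∀ q ∈ Icc (-l) l ×ˢ Icc 0 T, q.1 ∈ Ioo (-l) l → N q + lam ≤ V1 q ^ 2 + C * V q)
    (hW : ∀ x t, W x t = V (clamp l (x - σ t), t)) :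
    ∃ h₀ > 0, ∀ h, 0 < h → h < h₀ → ∀ x t, 0 ≤ t → t + μ * h ^ 2 ≤ T →
      Real.exp (Λ * (μ * h ^ 2)) * max (W x (t + μ * h ^ 2)) 0 ≤
        max (W x t) 0 + μ * (max (W (x + h) t) 0 ^ 2 - 2 * max (W x t) 0 ^ 2
          + max (W (x - h) t) 0 ^ 2)
        + μ * h ^ 2 * max (r x (clamp l (x - σ t), t) - lam / 4) 0 := by
  set Q := Icc (-l) l ×ˢ Icc 0 T with hQ
  have hcpt : IsCompact Q := isCompact_Icc.prod isCompact_Icc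
  obtain ⟨B, hB⟩ := hcpt.exists_bound_of_continuousOn hVc
  obtain ⟨L, hL⟩ := hcpt.exists_bound_of_continuousOn hV1c
  obtain ⟨Nb, hNb⟩ := hcpt.exists_bound_of_continuousOn hNc
  simp only [Real.norm_eq_abs] at hB hL hNb
  have h0Q : ((0:ℝ), (0:ℝ)) ∈ Q := ⟨⟨by linarith, hl.le⟩, ⟨le_rfl, hT⟩⟩
  have hB0 := (abs_nonneg _).trans (hB _ h0Q)
  have hL0 := (abs_nonneg _).trans (hL _ h0Q)
  have hNb0 := (abs_nonneg _).trans (hNb _ h0Q)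
  set ω := 3 / 4 * lam / (3 + Λ + 8 * L) with hωdef
  have hω : 0 < ω := by positivity
  have hωeq : ω * (3 + Λ + 8 * L) = 3 / 4 * lam := div_mul_cancel₀ _ (by positivity)
  have hLω : 0 ≤ L * ω := by positivity
  have hΛω : 0 < Λ * ω := by positivity
  have hEc : ContinuousOn (fun q => 2 * (V q * V2 q) + 2 * V1 q ^ 2) Q :=
    (continuousOn_const.mul (hVc.mul hV2c)).add (continuousOn_const.mul (hV1c.pow 2))
  obtain ⟨a1, ha1, hmV⟩ := exists_stencil_modulus hl hμ hω hk hVc hσ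
  obtain ⟨a2, ha2, hmV1⟩ := exists_stencil_modulus hl hμ hω hk hV1c hσ
  obtain ⟨a3, ha3, hmN⟩ := exists_stencil_modulus hl hμ hω hk hNc hσ
  obtain ⟨a4, ha4, hmE⟩ := exists_stencil_modulus hl hμ hω hk hEc hσ
  have hex : ∃ h₀ > 0, ∀ h, 0 < h → h < h₀ → Λ * (μ * h ^ 2) ≤ 1 ∧
      Λ ^ 2 * (μ * h ^ 2) * B ≤ ω ∧ μ * (Nb + ω) * h ≤ ω ∧ (Λ + C) * (L * h) ≤ ω := by
    have hh : ∀ F : ℝ → ℝ, Continuous F → F 0 = 0 → ∀ a > 0, ∀ᶠ h in nhds (0:ℝ), F h < a := by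
      intro F hF hF0 a ha
      exact hF.continuousAt.eventually (p := fun y => y < a) (by rw [hF0]; exact gt_mem_nhds ha)
    have := ((hh (fun h => Λ * (μ * h ^ 2)) (by fun_prop) (by simp) 1 one_pos).and
      (hh (fun h => Λ ^ 2 * (μ * h ^ 2) * B) (by fun_prop) (by simp) ω hω)).and
      ((hh (fun h => μ * (Nb + ω) * h) (by fun_prop) (by simp) ω hω).and
      (hh (fun h => (Λ + C) * (L * h)) (by fun_prop) (by simp) ω hω))
    obtain ⟨h₀, hh₀, H⟩ := Metric.eventually_nhds_iff.1 this
    refine ⟨h₀, hh₀, fun h h1 h2 => ?_⟩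
    have := H (y := h) (by rw [Real.dist_eq, sub_zero, abs_of_pos h1]; exact h2)
    exact ⟨this.1.1.le, this.1.2.le, this.2.1.le, this.2.2.le⟩
  obtain ⟨a5, ha5, hsm⟩ := hex
  refine ⟨min (min a1 a2) (min (min a3 a4) a5), by positivity, fun h hh hh₀ x t ht htT => ?_⟩
  simp only [lt_min_iff] at hh₀
  obtain ⟨⟨b1, b2⟩, ⟨b3, b4⟩, b5⟩ := hh₀
  obtain ⟨s1, s2, s3, s4⟩ := hsm h hh b5
  replace hmV := hmV h hh b1
  replace hmV1 := hmV1 h hh b2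
  replace hmN := hmN h hh b3
  replace hmE := hmE h hh b4
  set τ := μ * h ^ 2 with hτ
  have hτ0 : 0 < τ := by positivity
  have htI : t ∈ Icc 0 T := ⟨ht, by linarith⟩
  have htI' : t + τ ∈ Icc 0 T := ⟨by linarith, htT⟩
  set q : ℝ × ℝ := (clamp l (x - σ t), t) with hq
  have hqQ : q ∈ Q := ⟨clamp_mem hl _, htI⟩
  have hr0 : 0 ≤ τ * max (r x q - lam / 4) 0 := by positivity
  rcases le_or_gt (W x (t + τ)) 0 with hneg | hWpos
  · rw [max_eq_right hneg, mul_zero]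
    have hw0 : 0 ≤ max (W x t) 0 := le_max_right _ _
    have hw1 : 2 * μ * max (W x t) 0 ≤ 1 := by
      rcases max_choice (W x t) 0 with e | e
      · rw [e, hW]; exact hVμ q hqQ
      · rw [e, mul_zero]; exact zero_le_one
    have p1 := mul_le_mul_of_nonneg_right hw1 hw0
    have p2 : 0 ≤ μ * max (W (x + h) t) 0 ^ 2 := by positivity
    have p3 : 0 ≤ μ * max (W (x - h) t) 0 ^ 2 := by positivity
    linarith
  have hmW : ∀ y s, |y - x| ≤ h → t ≤ s → s ≤ t + τ →
      y - σ s ∈ Ioo (-l) l ∧ s ∈ Icc 0 T ∧ W y s = V (y - σ s, s) := by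
    intro y s hy hs1 hs2
    have hsI : s ∈ Icc 0 T := ⟨by linarith, by linarith⟩
    have m1 := hmV x y t s (by linarith) htI hsI (by rw [abs_le]; constructor <;> linarith)
    have m2 := hmV x x t (t + τ) (by simp; linarith) htI htI' (by
      rw [add_sub_cancel_left, abs_of_pos hτ0])
    rw [← hW, ← hW] at m1 m2
    have hin : clamp l (y - σ s) ∈ Ioo (-l) l := by
      refine hpos (clamp l (y - σ s), s) ⟨clamp_mem hl _, hsI⟩ ?_
      rw [← hW]
      linarith [(abs_le.1 m1).1, (abs_le.1 m2).2]
    have hin' := mem_of_clamp_mem hin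
    exact ⟨hin', hsI, by rw [hW, clamp_of_mem (Ioo_subset_Icc_self hin')]⟩
  have hxx : ∀ y ∈ Icc (x - h) (x + h), |y - x| ≤ h := fun y hy => by
    rw [abs_le]; constructor <;> linarith [hy.1, hy.2]
  have hx0 := hmW x t (by simp [hh.le]) le_rfl (by linarith)
  have hqe : q = (x - σ t, t) := by rw [hq, clamp_of_mem (Ioo_subset_Icc_self hx0.1)]
  have hqI : q.1 ∈ Ioo (-l) l := by rw [hqe]; exact hx0.1
  have hWq : W x t = V q := hW x t
  -- the time increment
  have htime : W x (t + τ) ≤ W x t + τ * (N q + ω) := by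
    have hx1 := hmW x (t + τ) (by simp [hh.le]) (by linarith) le_rfl
    rw [hx1.2.2, hx0.2.2]
    obtain ⟨s, hs, hs'⟩ := exists_hasDerivAt_eq_slope (fun s => V (x - σ s, s))
      (fun s => N (x - σ s, s)) (by linarith : t < t + τ)
      (fun s hs => by
        have := hmW x s (by simp [hh.le]) hs.1 hs.2
        exact (hN x s this.2.1 this.1).continuousAt.continuousWithinAt)
      (fun s hs => by
        have := hmW x s (by simp [hh.le]) hs.1.le hs.2.le
        exact hN x s this.2.1 this.1)
    have h1 := hmW x s (by simp [hh.le]) hs.1.le hs.2.le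
    have h2 := hmN x x t s (by simp; linarith) htI h1.2.1 (by
      rw [abs_le]; constructor <;> linarith [hs.1, hs.2])
    rw [clamp_of_mem (Ioo_subset_Icc_self h1.1), ← hq] at h2
    rw [add_sub_cancel_left, eq_div_iff hτ0.ne'] at hs'
    have h3 := mul_le_mul_of_nonneg_left (abs_le.1 h2).2 hτ0.le
    linarith
  have hsmall : W x (t + τ) ≤ W x t + ω := by
    have m2 := hmV x x t (t + τ) (by simp; linarith) htI htI' (by
      rw [add_sub_cancel_left, abs_of_pos hτ0])
    rw [← hW, ← hW] at m2
    linarith [(abs_le.1 m2).2]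
  have hWB : W x (t + τ) ≤ B := by
    rw [hW]
    exact (le_abs_self _).trans (hB _ ⟨clamp_mem hl _, htI'⟩)
  have hexp : Real.exp (Λ * τ) * W x (t + τ) ≤ W x t + τ * (N q + Λ * W x t + (2 + Λ) * ω) := by
    have e1 := Real.abs_exp_sub_one_sub_id_le (x := Λ * τ) (by
      rw [abs_of_nonneg (by positivity)]; exact s1)
    have e2 : Real.exp (Λ * τ) ≤ 1 + Λ * τ + (Λ * τ) ^ 2 := by linarith [(abs_le.1 e1).2]
    have e3 := mul_le_mul_of_nonneg_right e2 hWpos.le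
    have e4 : Λ * τ * W x (t + τ) ≤ Λ * τ * (W x t + ω) :=
      mul_le_mul_of_nonneg_left hsmall (by positivity)
    have e5 : (Λ * τ) ^ 2 * W x (t + τ) ≤ (Λ * τ) ^ 2 * B :=
      mul_le_mul_of_nonneg_left hWB (by positivity)
    have e6 : τ * (Λ ^ 2 * τ * B) ≤ τ * ω := mul_le_mul_of_nonneg_left s2 hτ0.le
    linarith
  have hVd : ∀ y ∈ Icc (x - h) (x + h),
      HasDerivAt (fun y => V (y - σ t, t)) (V1 (y - σ t, t)) y := fun y hy =>
    HasDerivAt.comp_sub_const y (σ t)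
      (hV t htI _ (hmW y t (hxx y hy) le_rfl (by linarith)).1)
  have hVd1 : ∀ y ∈ Icc (x - h) (x + h),
      HasDerivAt (fun y => V1 (y - σ t, t)) (V2 (y - σ t, t)) y := fun y hy =>
    HasDerivAt.comp_sub_const y (σ t)
      (hV1 t htI _ (hmW y t (hxx y hy) le_rfl (by linarith)).1)
  have hxr := hmW (x + h) t (by simp [abs_of_pos hh]) le_rfl (by linarith)
  have hxl := hmW (x - h) t (by simp [abs_of_pos hh]) le_rfl (by linarith)
  rw [max_eq_left hWpos.le]
  have hmx : W x t ≤ max (W x t) 0 := le_max_left _ _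
  suffices hS : h ^ 2 * (N q + Λ * W x t + (2 + Λ) * ω) ≤
      max (W (x + h) t) 0 ^ 2 + max (W (x - h) t) 0 ^ 2 - 2 * max (W x t) 0 ^ 2
      + h ^ 2 * max (r x q - lam / 4) 0 by
    have := mul_le_mul_of_nonneg_left hS hμ.le
    rw [hτ] at hexp ⊢
    linarith
  have hh2 : 0 < h ^ 2 := by positivity
  rcases le_or_gt (L * h) (W x t) with hc | hc
  · -- interior of the support
    have hlip : ∀ y ∈ Icc (x - h) (x + h), |V (y - σ t, t) - V (x - σ t, t)| ≤ L * h := by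
      intro y hy
      have := (convex_Icc (x - h) (x + h)).norm_image_sub_le_of_norm_hasDerivWithin_le
        (f := fun y => V (y - σ t, t)) (f' := fun y => V1 (y - σ t, t)) (C := L)
        (fun z hz => (hVd z hz).hasDerivWithinAt)
        (fun z hz => hL _ ⟨Ioo_subset_Icc_self (hmW z t (hxx z hz) le_rfl (by linarith)).1, htI⟩)
        (show x ∈ Icc (x - h) (x + h) from ⟨by linarith, by linarith⟩) hy
      exact this.trans (mul_le_mul_of_nonneg_left (hxx y hy) hL0)
    have hr' := (abs_le.1 (hlip (x + h) ⟨by linarith, le_rfl⟩)).1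
    have hl' := (abs_le.1 (hlip (x - h) ⟨le_rfl, by linarith⟩)).1
    rw [← hxr.2.2, ← hx0.2.2] at hr'
    rw [← hxl.2.2, ← hx0.2.2] at hl'
    have hLh : 0 ≤ L * h := by positivity
    have hsd := le_second_difference_sq hh hVd hVd1
      (k := 2 * (V q * V2 q) + 2 * V1 q ^ 2 - ω) (fun y hy => by
        have hy' := hmW y t (hxx y hy) le_rfl (by linarith)
        have := hmE x y t t (by linarith [hxx y hy]) htI htI (by simp [hτ0.le])
        rw [clamp_of_mem (Ioo_subset_Icc_self hy'.1), ← hq] at this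
        linarith [(abs_le.1 this).1])
    rw [← hxr.2.2, ← hxl.2.2, ← hx0.2.2] at hsd
    rw [max_eq_left (hLh.trans hc), max_eq_left (by linarith : 0 ≤ W (x + h) t),
      max_eq_left (by linarith : 0 ≤ W (x - h) t)]
    have hp := hP1 x q hqQ hqI (by rw [← hWq]; exact hLh.trans hc)
    rw [← hWq] at hp hsd
    have hrm : r x q - lam / 4 ≤ max (r x q - lam / 4) 0 := le_max_left _ _
    have hpt : N q + Λ * W x t + (2 + Λ) * ω ≤
        (2 * (W x t * V2 q) + 2 * V1 q ^ 2 - ω) + max (r x q - lam / 4) 0 := by linarith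
    have := mul_le_mul_of_nonneg_left hpt hh2.le
    linarith
  · -- near the edge of the support
    have hlow : -(ω * h) ≤ W x t := by
      have e1 : τ * (N q + ω) ≤ τ * (Nb + ω) :=
        mul_le_mul_of_nonneg_left (by linarith [(abs_le.1 (hNb q hqQ)).2]) hτ0.le
      have e2 : τ * (Nb + ω) ≤ ω * h := by
        have := mul_le_mul_of_nonneg_right s3 hh.le
        rw [hτ]
        linarith
      linarith
    have hqy : ∀ y ∈ Icc (x - h) (x + h), |V1 (y - σ t, t) - V1 (x - σ t, t)| ≤ ω := by
      intro y hy
      have hy' := hmW y t (hxx y hy) le_rfl (by linarith)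
      have := hmV1 x y t t (by linarith [hxx y hy]) htI htI (by simp [hτ0.le])
      rwa [clamp_of_mem (Ioo_subset_Icc_self hy'.1), ← hq, hqe] at this
    have hsd := le_second_difference_sq_max (L := L) hh hVd hqy
      (by rw [← hqe]; exact hL q hqQ) (by rw [← hx0.2.2]; exact hc.le)
      (by rw [← hx0.2.2]; exact hlow)
    rw [← hxr.2.2, ← hxl.2.2, ← hx0.2.2, ← hqe] at hsd
    have hp := hP2 q hqQ hqI
    rw [← hWq] at hp
    have hΛC : (Λ + C) * W x t ≤ ω :=
      (mul_le_mul_of_nonneg_left hc.le (by positivity)).trans s4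
    have hrm : 0 ≤ max (r x q - lam / 4) 0 := le_max_right _ _
    have hpt : N q + Λ * W x t + (2 + Λ) * ω ≤
        (V1 q ^ 2 - 8 * L * ω) + max (r x q - lam / 4) 0 := by linarith
    have := mul_le_mul_of_nonneg_left hpt hh2.le
    linarith

lemma subsolution_edge_inequality {a b η ℓ c s C₁ K : ℝ} (ha : 0 ≤ a) (hη : 0 ≤ η) (hη1 : η ≤ 1)
    (hℓ : 0 ≤ ℓ) (hC₁ : 0 ≤ C₁) (hb : -(C₁ * a) ≤ b ^ 2 + c * b)
    (hbs : -(C₁ * a) ≤ b ^ 2 + s * b) (hK : 2 * C₁ + 1 ≤ K) :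
    -(K * η * a) - (c + s * η) * (1 + η) * b - K * ℓ + ℓ
      ≤ ((1 + η) * b) ^ 2 + 2 * C₁ * ((1 + η) * a - ℓ) := by
  have h1 := mul_le_mul_of_nonneg_left hb (by linarith : 0 ≤ 1 + η)
  have h2 := mul_le_mul_of_nonneg_left hbs (by positivity : 0 ≤ (1 + η) * η)
  have h3 : (2 * C₁ + 1) * ℓ ≤ K * ℓ := mul_le_mul_of_nonneg_right hK hℓ
  have h4 : 0 ≤ K * η * a := by
    have : 0 ≤ K := by linarith
    positivity
  have h5 : (1 + η) * η * (C₁ * a) ≤ (1 + η) * 1 * (C₁ * a) := by gcongr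
  linarith

lemma subsolution_interior_inequality {a b d η ℓ c s C₁ C₂ Λ K G G' v w : ℝ} (ha : 0 ≤ a)
    (hη : 0 ≤ η) (hη1 : η ≤ 1) (hℓ : 0 ≤ ℓ) (hC₁ : 0 ≤ C₁) (hΛ : 0 ≤ Λ) (hd : |d| ≤ C₂)
    (hv : v = (1 + η) * a - ℓ) (hv0 : 0 ≤ v) (hw : w = max (v - ℓ) 0)
    (hB : 0 ≤ 2 * a * d + 2 * b ^ 2 + c * b + G) (hbs : -(C₁ * a) ≤ b ^ 2 + s * b)
    (hG : |G| ≤ Λ * a) (hG' : |G' - G| ≤ Λ * |w - a|) (hK : 4 * C₂ + 2 * C₁ + 3 * Λ + 1 ≤ K) :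
    -(K * η * a) - (c + s * η) * (1 + η) * b - K * ℓ + Λ * v + ℓ
      ≤ 2 * (v * ((1 + η) * d)) + 2 * ((1 + η) * b) ^ 2 + (G' + Λ * w) := by
  have hC₂ : 0 ≤ C₂ := (abs_nonneg _).trans hd
  have hηa : 0 ≤ η * a := mul_nonneg hη ha
  have hwv : v - ℓ ≤ w := by rw [hw]; exact le_max_left _ _
  have hwv' : w ≤ v := by rw [hw]; exact max_le (by linarith) hv0
  have hwa : |w - a| ≤ 2 * ℓ + η * a := by rw [abs_le]; constructor <;> linarith
  have g1 : G - Λ * (2 * ℓ + η * a) ≤ G' := by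
    have := mul_le_mul_of_nonneg_left hwa hΛ
    linarith [(abs_le.1 hG').1]
  have g2 : η * G ≤ η * (Λ * a) := mul_le_mul_of_nonneg_left ((le_abs_self _).trans hG) hη
  have g3 : Λ * (v - ℓ) ≤ Λ * w := mul_le_mul_of_nonneg_left hwv hΛ
  have b1 := mul_le_mul_of_nonneg_left hB (by linarith : 0 ≤ 1 + η)
  have b2 := mul_le_mul_of_nonneg_left hbs (by positivity : 0 ≤ (1 + η) * η)
  have b3 : 0 ≤ (1 + η) * η * b ^ 2 := by positivity
  have hd' := abs_le.1 hd
  have d1 : -(2 * (η * a) * (2 * C₂)) ≤ 2 * (η * a) * ((1 + η) * d) := by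
    have : -(2 * C₂) ≤ (1 + η) * d := by nlinarith
    have := mul_le_mul_of_nonneg_left this (by linarith : 0 ≤ 2 * (η * a))
    linarith
  have d2 : 2 * ℓ * ((1 + η) * d) ≤ 2 * ℓ * (2 * C₂) := by
    have : (1 + η) * d ≤ 2 * C₂ := by nlinarith
    exact mul_le_mul_of_nonneg_left this (by linarith)
  have k1 := mul_le_mul_of_nonneg_right hK hηa
  have k2 := mul_le_mul_of_nonneg_right hK hℓ
  have c1 : (1 + η) * η * (C₁ * a) ≤ (1 + 1) * η * (C₁ * a) := by gcongr
  have c2 : 0 ≤ C₁ * ℓ := by positivity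
  have c3 : 0 ≤ Λ * (η * a) := by positivity
  subst hv
  linarith

/-- The centre of a travelling profile with speed `c + s ε exp (-K t)`, starting at `-l`. -/
def frameCenter (c l s ε K t : ℝ) : ℝ := c * t - l + s * ε * (1 - Real.exp (-(K * t))) / K

/-- An amplified profile, lowered by an exponentially growing amount. -/
def loweredProfile (φ : ℝ → ℝ) (ε K lam : ℝ) (q : ℝ × ℝ) : ℝ :=
  (1 + ε * Real.exp (-(K * q.2))) * φ q.1 - lam * Real.exp (K * q.2)

lemma hasDerivAt_exp_neg_mul (K t : ℝ) :
    HasDerivAt (fun t => Real.exp (-(K * t))) (-(K * Real.exp (-(K * t)))) t :=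
  (((hasDerivAt_id t).const_mul K).neg.exp).congr_deriv (by simp; ring)

lemma hasDerivAt_frameCenter {c l s ε K : ℝ} (hK : K ≠ 0) (t : ℝ) :
    HasDerivAt (frameCenter c l s ε K) (c + s * (ε * Real.exp (-(K * t)))) t := by
  have h := (((hasDerivAt_id t).const_mul c).sub_const l).add
    ((((hasDerivAt_exp_neg_mul K t).const_sub 1).const_mul (s * ε)).div_const K)
  refine h.congr_deriv ?_
  field_simp

lemma abs_frameCenter_sub_le {c l s ε K : ℝ} (hK : 0 < K) (hc : 0 ≤ c) (hs : 0 ≤ s)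
    (hε : 0 ≤ ε) {T : ℝ} : ∀ x ∈ Icc 0 T, ∀ t ∈ Icc 0 T,
    |frameCenter c l s ε K x - frameCenter c l s ε K t| ≤ (c + s * ε) * |x - t| := by
  intro x hx t ht
  refine (convex_Icc 0 T).norm_image_sub_le_of_norm_hasDerivWithin_le
    (fun z _ => (hasDerivAt_frameCenter hK.ne' z).hasDerivWithinAt) (fun z hz => ?_) ht hx
  have : Real.exp (-(K * z)) ≤ 1 := Real.exp_le_one_iff.2 (by
    have := mul_nonneg hK.le hz.1
    linarith)
  rw [Real.norm_eq_abs, abs_of_nonneg (by positivity)]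
  have := mul_le_mul_of_nonneg_left this (mul_nonneg hs hε)
  linarith

lemma continuousOn_loweredProfile {φ : ℝ → ℝ} {ε K lam l T : ℝ} (hφ : ContinuousOn φ (Icc (-l) l)) :
    ContinuousOn (loweredProfile φ ε K lam) (Icc (-l) l ×ˢ Icc 0 T) := by
  have h : ContinuousOn (fun q : ℝ × ℝ => φ q.1) (Icc (-l) l ×ˢ Icc 0 T) :=
    hφ.comp continuousOn_fst fun q hq => hq.1
  exact ((by fun_prop : Continuous fun q : ℝ × ℝ =>
    1 + ε * Real.exp (-(K * q.2))).continuousOn.mul h).sub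
    (by fun_prop : Continuous fun q : ℝ × ℝ => lam * Real.exp (K * q.2)).continuousOn

lemma exists_discrete_travelling_subsolution {f : ℝ → ℝ → ℝ} {κ φ φ1 φ2 : ℝ → ℝ}
    {c l s ε K lam T μ Λ M C₁ C₂ : ℝ} (hl : 0 < l) (hT : 0 ≤ T) (hlam : 0 < lam) (hμ : 0 < μ)
    (hΛ : 0 < Λ) (hC₁ : 0 ≤ C₁) (hs : 0 ≤ s) (hsc : s ≤ c) (hε : 0 ≤ ε) (hε1 : ε ≤ 1)
    (hK : 4 * C₂ + 2 * C₁ + 3 * Λ + 1 ≤ K) (hμM : 2 * μ * M ≤ 1)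
    (hφc : ContinuousOn φ (Icc (-l) l)) (hφ1c : ContinuousOn φ1 (Icc (-l) l))
    (hφ2c : ContinuousOn φ2 (Icc (-l) l)) (hφl' : φ (-l) = 0) (hφl : φ l = 0)
    (hφp : ∀ z ∈ Ioo (-l) l, 0 < φ z) (hφM : ∀ z ∈ Icc (-l) l, 2 * φ z ≤ M)
    (hφ1 : ∀ z ∈ Ioo (-l) l, HasDerivAt φ (φ1 z) z)
    (hφ2 : ∀ z ∈ Ioo (-l) l, HasDerivAt φ1 (φ2 z) z)
    (hB : ∀ y, ∀ z ∈ Ioo (-l) l, 0 ≤ 2 * φ z * φ2 z + 2 * φ1 z ^ 2 + c * φ1 z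
        + f y (φ z) * (κ y - φ z))
    (hA : ∀ z ∈ Ioo (-l) l, -(C₁ * φ z) ≤ φ1 z ^ 2 + c * φ1 z)
    (hC₂ : ∀ z ∈ Icc (-l) l, |φ2 z| ≤ C₂) (hf0 : ∀ x, f x 0 = 0)
    (hLip : ∀ x y a b, |x - y| ≤ 1 → a ∈ Icc 0 M → b ∈ Icc 0 M →
      |f x a * (κ x - a) - f y b * (κ y - b)| ≤ Λ * (|x - y| + |a - b|))
    {W : ℝ → ℝ → ℝ} (hW : ∀ x t, W x t =
      loweredProfile φ ε K lam (clamp l (x - frameCenter c l s ε K t), t))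
    {r : ℝ → ℝ × ℝ → ℝ} (hr : ∀ x q, r x q =
      f x (max (loweredProfile φ ε K lam q - lam * Real.exp (K * q.2)) 0) *
        (κ x - max (loweredProfile φ ε K lam q - lam * Real.exp (K * q.2)) 0)
        + Λ * max (loweredProfile φ ε K lam q - lam * Real.exp (K * q.2)) 0) :
    ∃ h₀ > 0, ∀ h, 0 < h → h < h₀ → ∀ x t, 0 ≤ t → t + μ * h ^ 2 ≤ T →
      Real.exp (Λ * (μ * h ^ 2)) * max (W x (t + μ * h ^ 2)) 0 ≤
        max (W x t) 0 + μ * (max (W (x + h) t) 0 ^ 2 - 2 * max (W x t) 0 ^ 2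
          + max (W (x - h) t) 0 ^ 2)
        + μ * h ^ 2 * max (r x (clamp l (x - frameCenter c l s ε K t), t) - lam / 4) 0 := by
  have hC₂0 : 0 ≤ C₂ := (abs_nonneg _).trans (hC₂ l ⟨by linarith, le_rfl⟩)
  have hK0 : 0 < K := by linarith
  have hc : 0 ≤ c := hs.trans hsc
  have hφ0 : ∀ z ∈ Icc (-l) l, 0 ≤ φ z := by
    intro z hz
    rcases hz.1.eq_or_lt with h | h
    · rw [← h, hφl']
    rcases hz.2.eq_or_lt with h' | h'
    · rw [h', hφl]
    · exact (hφp z ⟨h, h'⟩).le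
  have hη0 : ∀ t, 0 ≤ ε * Real.exp (-(K * t)) := fun t => by positivity
  have hη1 : ∀ t ∈ Icc 0 T, ε * Real.exp (-(K * t)) ≤ 1 := by
    intro t ht
    have : Real.exp (-(K * t)) ≤ 1 := Real.exp_le_one_iff.2 (by
      have := mul_nonneg hK0.le ht.1
      linarith)
    exact mul_le_one₀ hε1 (Real.exp_pos _).le this
  have hℓ : ∀ t ∈ Icc 0 T, lam ≤ lam * Real.exp (K * t) := fun t ht =>
    le_mul_of_one_le_right hlam.le (Real.one_le_exp (mul_nonneg hK0.le ht.1))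
  have hVM : ∀ q ∈ Icc (-l) l ×ˢ Icc 0 T,
      loweredProfile φ ε K lam q ≤ M - lam * Real.exp (K * q.2) := by
    intro q hq
    have h1 := mul_le_mul_of_nonneg_right (hη1 _ hq.2) (hφ0 _ hq.1)
    have h2 := hφM _ hq.1
    unfold loweredProfile
    linarith
  have hA' : ∀ z ∈ Ioo (-l) l, -(C₁ * φ z) ≤ φ1 z ^ 2 + s * φ1 z := by
    intro z hz
    have h1 := hA z hz
    have h2 := mul_nonneg hC₁ (hφp z hz).le
    rcases le_total 0 (φ1 z) with h | h
    · nlinarith [mul_nonneg hs h, sq_nonneg (φ1 z)]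
    · nlinarith [mul_le_mul_of_nonpos_right hsc h]
  have hfst : ∀ {g : ℝ → ℝ}, ContinuousOn g (Icc (-l) l) →
      ContinuousOn (fun q : ℝ × ℝ => g q.1) (Icc (-l) l ×ˢ Icc 0 T) := fun hg =>
    hg.comp continuousOn_fst fun q hq => hq.1
  have q0 := hfst hφc
  have q1 := hfst hφ1c
  have q2 := hfst hφ2c
  have hA₀ : ContinuousOn (fun q : ℝ × ℝ => 1 + ε * Real.exp (-(K * q.2)))
      (Icc (-l) l ×ˢ Icc 0 T) := by fun_prop
  refine exists_discrete_subsolution (V := loweredProfile φ ε K lam)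
    (V1 := fun q => (1 + ε * Real.exp (-(K * q.2))) * φ1 q.1)
    (V2 := fun q => (1 + ε * Real.exp (-(K * q.2))) * φ2 q.1)
    (N := fun q => -(K * (ε * Real.exp (-(K * q.2))) * φ q.1)
      - (c + s * (ε * Real.exp (-(K * q.2)))) * (1 + ε * Real.exp (-(K * q.2))) * φ1 q.1
      - K * (lam * Real.exp (K * q.2)))
    (r := r) (C := 2 * C₁) (k := c + s * ε) hl hT hlam hμ hΛ (by positivity) (by positivity)
    (continuousOn_loweredProfile hφc) (hA₀.mul q1) (hA₀.mul q2)
    (((((by fun_prop : Continuous fun q : ℝ × ℝ =>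
      K * (ε * Real.exp (-(K * q.2)))).continuousOn.mul q0).neg).sub
      ((by fun_prop : Continuous fun q : ℝ × ℝ => (c + s * (ε * Real.exp (-(K * q.2)))) *
        (1 + ε * Real.exp (-(K * q.2)))).continuousOn.mul q1)).sub
      (by fun_prop : Continuous fun q : ℝ × ℝ => K * (lam * Real.exp (K * q.2))).continuousOn)
    (abs_frameCenter_sub_le hK0 hc hs hε) ?_ ?_ ?_ ?_ ?_ ?_ ?_ hW
  · intro q hq
    have h1 : loweredProfile φ ε K lam q ≤ M := by
      have := hVM q hq
      have : 0 ≤ lam * Real.exp (K * q.2) := by positivity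
      linarith
    have := mul_le_mul_of_nonneg_left h1 (by positivity : 0 ≤ 2 * μ)
    linarith
  · intro q hq hq'
    have h1 : 0 < φ q.1 := by
      by_contra hn
      have h2 : φ q.1 = 0 := le_antisymm (not_lt.1 hn) (hφ0 _ hq.1)
      unfold loweredProfile at hq'
      rw [h2] at hq'
      linarith [hℓ _ hq.2]
    refine ⟨lt_of_le_of_ne hq.1.1 fun h => ?_, lt_of_le_of_ne hq.1.2 fun h => ?_⟩
    · rw [← h, hφl'] at h1
      exact lt_irrefl _ h1
    · rw [h, hφl] at h1
      exact lt_irrefl _ h1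
  · intro t _ z hz
    exact ((hφ1 z hz).const_mul (1 + ε * Real.exp (-(K * t)))).sub_const (lam * Real.exp (K * t))
  · intro t _ z hz
    exact (hφ2 z hz).const_mul (1 + ε * Real.exp (-(K * t)))
  · intro x t _ hx
    have d1 : HasDerivAt (fun t => x - frameCenter c l s ε K t)
        (-(c + s * (ε * Real.exp (-(K * t))))) t := (hasDerivAt_frameCenter hK0.ne' t).const_sub x
    have d2 := (hφ1 _ hx).comp t d1
    have d3 := ((hasDerivAt_exp_neg_mul K t).const_mul ε).const_add 1
    have d4 : HasDerivAt (fun t => lam * Real.exp (K * t)) (lam * (Real.exp (K * t) * K)) t :=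
      ((((hasDerivAt_id t).const_mul K).congr_deriv (mul_one K)).exp).const_mul lam
    refine ((d3.mul d2).sub d4).congr_deriv ?_
    simp only [Function.comp_apply]
    ring
  · intro x q hq hqI hq0
    have hℓ0 := hlam.le.trans (hℓ _ hq.2)
    have hM0 : 0 ≤ M := by linarith [hφ0 _ hq.1, hφM _ hq.1]
    have hw : max (loweredProfile φ ε K lam q - lam * Real.exp (K * q.2)) 0 ∈ Icc 0 M :=
      ⟨le_max_right _ _, max_le (by linarith [hVM q hq]) hM0⟩
    have ha : φ q.1 ∈ Icc 0 M := ⟨hφ0 _ hq.1, by linarith [hφ0 _ hq.1, hφM _ hq.1]⟩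
    have g1 := hLip x x _ _ (by simp) ha ⟨le_rfl, hM0⟩
    have g2 := hLip x x _ _ (by simp) hw ha
    rw [hf0] at g1
    simp only [zero_mul, sub_zero, sub_self, abs_zero, zero_add, abs_of_nonneg ha.1] at g1 g2
    have := subsolution_interior_inequality (K := K) (s := s) (c := c) ha.1 (hη0 q.2) (hη1 _ hq.2)
      hℓ0 hC₁ hΛ.le (hC₂ _ hq.1) (v := loweredProfile φ ε K lam q) rfl hq0 rfl
      (hB x _ hqI) (hA' _ hqI) g1 g2 hK
    rw [hr]
    linarith [hℓ _ hq.2]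
  · intro q hq hqI
    have hℓ0 := hlam.le.trans (hℓ _ hq.2)
    have := subsolution_edge_inequality (K := K) (c := c) (s := s) (hφ0 _ hq.1) (hη0 q.2)
      (hη1 _ hq.2) hℓ0 hC₁ (hA _ hqI) (hA' _ hqI) (by linarith)
    unfold loweredProfile
    linarith [hℓ _ hq.2]

/-- Amplified travelling profiles that start below the initial datum stay below the solution. -/
theorem travelling_profile_le {f : ℝ → ℝ → ℝ} {κ φ φ1 φ2 u₀ : ℝ → ℝ} {u : ℝ → ℝ → ℝ}
    {c l s ε K T Λ M C₁ C₂ : ℝ} (hl : 0 < l) (hM : 0 < M)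
    (hΛ : 0 < Λ) (hC₁ : 0 ≤ C₁) (hs : 0 ≤ s) (hsc : s ≤ c) (hε : 0 ≤ ε) (hε1 : ε ≤ 1)
    (hK : 4 * C₂ + 2 * C₁ + 3 * Λ + 1 ≤ K)
    (hφc : ContinuousOn φ (Icc (-l) l)) (hφ1c : ContinuousOn φ1 (Icc (-l) l))
    (hφ2c : ContinuousOn φ2 (Icc (-l) l)) (hφl' : φ (-l) = 0) (hφl : φ l = 0)
    (hφp : ∀ z ∈ Ioo (-l) l, 0 < φ z) (hφM : ∀ z ∈ Icc (-l) l, 2 * φ z ≤ M)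
    (hφ1 : ∀ z ∈ Ioo (-l) l, HasDerivAt φ (φ1 z) z)
    (hφ2 : ∀ z ∈ Ioo (-l) l, HasDerivAt φ1 (φ2 z) z)
    (hB : ∀ y, ∀ z ∈ Ioo (-l) l, 0 ≤ 2 * φ z * φ2 z + 2 * φ1 z ^ 2 + c * φ1 z
        + f y (φ z) * (κ y - φ z))
    (hA : ∀ z ∈ Ioo (-l) l, -(C₁ * φ z) ≤ φ1 z ^ 2 + c * φ1 z)
    (hC₂ : ∀ z ∈ Icc (-l) l, |φ2 z| ≤ C₂) (hf0 : ∀ x, f x 0 = 0)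
    (hLip : ∀ x y a b, |x - y| ≤ 1 → a ∈ Icc 0 M → b ∈ Icc 0 M →
      |f x a * (κ x - a) - f y b * (κ y - b)| ≤ Λ * (|x - y| + |a - b|))
    (hu₀ : ∀ x, u₀ x ∈ Icc 0 M) (hu : ∀ x, ∀ t ∈ Ioc 0 T, u x t ∈ Icc 0 M)
    (huc : ContinuousOn (fun q : ℝ × ℝ => u q.1 q.2) (univ ×ˢ Ioc (0:ℝ) T))
    (hav : ∀ τ ∈ Ioc 0 T, HasAverages τ (fun t => Real.exp (-(Λ * t)))
      (fun z t => Real.exp (Λ * t) * if t ≤ 0 then u₀ z else u z t)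
      (fun z t => Real.exp (Λ * t) * (f z (u z t) * (κ z - u z t) + Λ * u z t)))
    (hinit : ∀ x, (1 + ε) * φ (clamp l (x + l)) ≤ u₀ x) :
    ∀ x, ∀ t ∈ Ioc 0 T, (1 + ε * Real.exp (-(K * t))) *
      φ (clamp l (x - frameCenter c l s ε K t)) ≤ u x t := by
  have hc : 0 ≤ c := hs.trans hsc
  have hC₂0 : 0 ≤ C₂ := (abs_nonneg _).trans (hC₂ l ⟨by linarith, le_rfl⟩)
  have hK0 : 0 < K := by linarith
  have hM00 : (0:ℝ) ∈ Icc 0 M := ⟨le_rfl, hM.le⟩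
  have hg0 : ∀ z, ∀ a ∈ Icc 0 M, 0 ≤ f z a * (κ z - a) + Λ * a ∧
      f z a * (κ z - a) + Λ * a ≤ 2 * Λ * M := by
    intro z a ha
    have g1 := hLip z z _ _ (by simp) ha hM00
    rw [hf0] at g1
    simp only [zero_mul, sub_zero, sub_self, abs_zero, zero_add, abs_of_nonneg ha.1] at g1
    have := mul_le_mul_of_nonneg_left ha.2 hΛ.le
    constructor <;> linarith [(abs_le.1 g1).1, (abs_le.1 g1).2]
  have hgm : ∀ z x a b d, |z - x| ≤ 1 → a ∈ Icc 0 M → b ∈ Icc 0 M → 0 ≤ d → a - d ≤ b →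
      f x a * (κ x - a) + Λ * a - Λ * |z - x| - 2 * Λ * d ≤ f z b * (κ z - b) + Λ * b := by
    intro z x a b d hzx ha hb hd hab
    have g1 := (abs_le.1 (hLip z x b a hzx hb ha)).1
    rcases le_total a b with h | h
    · rw [abs_of_nonneg (sub_nonneg.2 h)] at g1
      have := mul_nonneg hΛ.le hd
      linarith
    · rw [abs_of_nonpos (sub_nonpos.2 h)] at g1
      have := mul_le_mul_of_nonneg_left (by linarith : a - b ≤ d) hΛ.le
      linarith
  have hamp : ∀ x t, 0 ≤ t →
      (1 + ε * Real.exp (-(K * t))) * φ (clamp l (x - frameCenter c l s ε K t)) ≤ M := by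
    intro x t ht
    have e1 : ε * Real.exp (-(K * t)) ≤ 1 := mul_le_one₀ hε1 (Real.exp_pos _).le
      (Real.exp_le_one_iff.2 (by
        have := mul_nonneg hK0.le ht
        linarith))
    have e2 := hφM _ (clamp_mem hl (x - frameCenter c l s ε K t))
    rcases le_total 0 (φ (clamp l (x - frameCenter c l s ε K t))) with e | e
    · have := mul_le_mul_of_nonneg_right e1 e
      linarith
    · have := mul_nonpos_of_nonneg_of_nonpos
        (by positivity : 0 ≤ 1 + ε * Real.exp (-(K * t))) e
      linarith
  have step : ∀ lam > 0,
      (∀ x, ∀ t ∈ Ioc 0 T, loweredProfile φ ε K (2 * lam)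
        (clamp l (x - frameCenter c l s ε K t), t) ≤ u x t) →
      ∀ x, ∀ t ∈ Ioc 0 T, loweredProfile φ ε K lam
        (clamp l (x - frameCenter c l s ε K t), t) ≤ u x t := by
    intro lam hlam hP x₁ τ hτ
    have hτ0 : 0 < τ := hτ.1
    set E := Real.exp (Λ * τ) with hE
    have hE0 : 0 < E := Real.exp_pos _
    have hE1 : 1 ≤ E := Real.one_le_exp (by positivity)
    have hEt : ∀ t, t ≤ τ → Real.exp (Λ * t) ≤ E := fun t ht =>
      Real.exp_le_exp.2 (mul_le_mul_of_nonneg_left ht hΛ.le)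
    set μ := 1 / (4 * (E * M + τ * (E * (2 * Λ * M)))) with hμdef
    have hμ : 0 < μ := by positivity
    have hμM : 4 * μ * (E * M + τ * (E * (2 * Λ * M))) ≤ 1 := by
      rw [hμdef]
      field_simp
      exact le_rfl
    have hμM' : 2 * μ * M ≤ 1 := by
      have h1 : M ≤ E * M + τ * (E * (2 * Λ * M)) := by
        have : 0 ≤ τ * (E * (2 * Λ * M)) := by positivity
        nlinarith
      have := mul_le_mul_of_nonneg_left h1 hμ.le
      have : 0 ≤ μ * M := by positivity
      linarith
    set W : ℝ → ℝ → ℝ := fun x t =>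
      loweredProfile φ ε K lam (clamp l (x - frameCenter c l s ε K t), t) with hW
    set w : ℝ × ℝ → ℝ := fun q =>
      max (loweredProfile φ ε K lam q - lam * Real.exp (K * q.2)) 0 with hw
    obtain ⟨a1, ha1, hdisc⟩ := exists_discrete_travelling_subsolution (W := W)
      (r := fun x q => f x (w q) * (κ x - w q) + Λ * w q) hl hτ0.le hlam hμ hΛ hC₁ hs hsc hε hε1
      hK hμM' hφc hφ1c hφ2c hφl' hφl hφp hφM hφ1 hφ2 hB hA hC₂ hf0 hLip (fun _ _ => rfl)
      (fun _ _ => rfl)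
    have hσ := abs_frameCenter_sub_le (l := l) (T := τ) hK0 hc hs hε
    obtain ⟨a2, ha2, hmod⟩ := exists_stencil_modulus (ω := lam / (16 * Λ)) hl hμ (by positivity)
      (by positivity) (continuousOn_loweredProfile (lam := 2 * lam) (ε := ε) (K := K) (T := τ) hφc)
      hσ
    obtain ⟨a3, ha3, hmod0⟩ := exists_stencil_modulus hl hμ hlam
      (by positivity) (continuousOn_loweredProfile (lam := lam) (ε := ε) (K := K) (T := τ) hφc) hσ
    have hfc0 : frameCenter c l s ε K 0 = -l := by simp [frameCenter]
    have hcomp := (hav τ hτ).comparison (Y := fun x t => Real.exp (Λ * t) * max (W x t) 0) hτ0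
      (by positivity : 0 < E * M) (by positivity : 0 ≤ E * (2 * Λ * M)) hμ hμM (by fun_prop)
      (fun t ht => ⟨(Real.exp_pos _).le, Real.exp_le_one_iff.2 (by
        have := mul_nonneg hΛ.le ht
        linarith)⟩) ?_ ?_ ?_ (fun x t _ _ => by positivity) ?_ ?_ ?_ x₁
    · simp only [if_neg hτ0.not_ge] at hcomp
      exact (le_max_left _ _).trans (le_of_mul_le_mul_left hcomp hE0)
    · intro x t ht htτ
      have : (if t ≤ 0 then u₀ x else u x t) ∈ Icc 0 M := by
        split_ifs with h
        · exact hu₀ x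
        · exact hu x t ⟨not_le.1 h, htτ.trans hτ.2⟩
      exact ⟨mul_nonneg (Real.exp_pos _).le this.1,
        mul_le_mul (hEt t htτ) this.2 this.1 hE0.le⟩
    · intro x t ht htτ
      have := hg0 x _ (hu x t ⟨ht, htτ.trans hτ.2⟩)
      exact ⟨mul_nonneg (Real.exp_pos _).le this.1,
        mul_le_mul (hEt t htτ) this.2 this.1 hE0.le⟩
    · have h1 : ContinuousOn (fun q : ℝ × ℝ => Real.exp (Λ * q.2) * u q.1 q.2)
          (univ ×ˢ Ioc (0:ℝ) τ) :=
        (by fun_prop : Continuous fun q : ℝ × ℝ => Real.exp (Λ * q.2)).continuousOn.mul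
          (huc.mono (prod_mono_right (Ioc_subset_Ioc_right hτ.2)))
      refine h1.congr fun q hq => ?_
      simp only [if_neg hq.2.1.not_ge]
    · have h1 : Continuous fun x => W x τ :=
        (continuousOn_loweredProfile (T := τ) hφc).comp_continuous
          (((continuous_clamp l).comp (continuous_id.sub continuous_const)).prodMk
            continuous_const) fun x => ⟨clamp_mem hl _, hτ0.le, le_rfl⟩
      exact continuous_const.mul (h1.max continuous_const)
    · refine ⟨a3, ha3, fun h hh hh₀ x z hz => ?_⟩
      simp only [mul_zero, Real.exp_zero, one_mul, le_refl, if_true]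
      refine max_le ?_ (hu₀ z).1
      have h1 := (abs_le.1 (hmod0 h hh hh₀ x z 0 0 hz ⟨le_rfl, hτ0.le⟩ ⟨le_rfl, hτ0.le⟩
        (by simp; positivity))).1
      have h2 := hinit z
      simp only [loweredProfile, hfc0, sub_neg_eq_add, mul_zero, neg_zero, Real.exp_zero,
        mul_one] at h1
      simp only [hW, loweredProfile, hfc0, sub_neg_eq_add, mul_zero, neg_zero, Real.exp_zero,
        mul_one]
      linarith
    · refine ⟨min (min a1 a2) (min (1 / 2) (lam / (16 * Λ))), by positivity,
        fun h hh hh₀ x t ht htτ => ?_⟩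
      simp only [lt_min_iff] at hh₀
      obtain ⟨⟨b1, b2⟩, b3, b4⟩ := hh₀
      set q : ℝ × ℝ := (clamp l (x - frameCenter c l s ε K t), t) with hq
      have htI : t ∈ Icc 0 τ := ⟨ht, by
        have : 0 ≤ μ * h ^ 2 := by positivity
        linarith⟩
      refine ⟨Real.exp (Λ * t) * max (f x (w q) * (κ x - w q) + Λ * w q - lam / 4) 0,
        fun z s' hz hs1 hs2 => ?_, ?_⟩
      · have hsI : s' ∈ Ioc 0 τ := ⟨ht.trans_lt hs1, hs2.trans htτ⟩
        have hsT : s' ∈ Ioc 0 T := ⟨hsI.1, hsI.2.trans hτ.2⟩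
        have hexp : Real.exp (Λ * t) ≤ Real.exp (Λ * s') :=
          Real.exp_le_exp.2 (mul_le_mul_of_nonneg_left hs1.le hΛ.le)
        refine mul_le_mul hexp ?_ (le_max_right _ _) (Real.exp_pos _).le
        have hus := hu z s' hsT
        refine max_le ?_ (hg0 z _ hus).1
        have hwq : w q = max (loweredProfile φ ε K (2 * lam) q) 0 := by
          simp only [hw, loweredProfile]
          congr 1
          ring
        have hm := (abs_le.1 (hmod h hh b2 x z t s' hz htI ⟨hsI.1.le, hsI.2⟩ (by
          rw [abs_le]; constructor <;> linarith))).1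
        have hPz := hP z s' hsT
        have hwu : w q - lam / (16 * Λ) ≤ u z s' := by
          have h0 : 0 ≤ lam / (16 * Λ) := by positivity
          rw [hwq, sub_le_iff_le_add]
          exact max_le (by linarith) (by linarith [hus.1])
        have hwM : w q ∈ Icc 0 M := by
          refine ⟨le_max_right _ _, max_le ?_ hM.le⟩
          have h1 : loweredProfile φ ε K lam q ≤ M := by
            have e1 := hamp x t ht
            have e2 : 0 ≤ lam * Real.exp (K * t) := by positivity
            simp only [loweredProfile, hq]
            linarith
          have : 0 ≤ lam * Real.exp (K * q.2) := by positivity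
          linarith
        have hgq := hgm z x (w q) (u z s') _ (by linarith) hwM hus (by positivity) hwu
        have e1 : Λ * |z - x| ≤ Λ * (2 * (lam / (16 * Λ))) :=
          mul_le_mul_of_nonneg_left (by linarith) hΛ.le
        have e2 : Λ * (lam / (16 * Λ)) = lam / 16 := by field_simp
        linarith
      · have hd := mul_le_mul_of_nonneg_left (hdisc h hh b1 x t ht htτ) (Real.exp_pos (Λ * t)).le
        have e1 : Real.exp (Λ * (t + μ * h ^ 2))
            = Real.exp (Λ * t) * Real.exp (Λ * (μ * h ^ 2)) := by
          rw [← Real.exp_add]; ring_nf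
        have e2 : Real.exp (-(Λ * t)) * Real.exp (Λ * t) = 1 := by
          rw [← Real.exp_add]; simp
        simp only [e1]
        refine (mul_assoc _ _ _).trans_le (hd.trans_eq ?_)
        have e3 : ∀ v : ℝ, μ * Real.exp (-(Λ * t)) * (Real.exp (Λ * t) * v) ^ 2
            = μ * Real.exp (Λ * t) * v ^ 2 := fun v => by
          calc _ = μ * (Real.exp (-(Λ * t)) * Real.exp (Λ * t)) * Real.exp (Λ * t) * v ^ 2 := by
                ring
            _ = _ := by rw [e2]; ring
        rw [mul_add (μ * Real.exp (-(Λ * t))), mul_sub (μ * Real.exp (-(Λ * t))), e3, e3,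
          mul_left_comm _ (2:ℝ), e3]
        ring
  have hall : ∀ n : ℕ, ∀ x, ∀ t ∈ Ioc 0 T, loweredProfile φ ε K (M / 2 ^ n)
      (clamp l (x - frameCenter c l s ε K t), t) ≤ u x t := by
    intro n
    induction n with
    | zero =>
      intro x t ht
      have e1 := hamp x t ht.1.le
      have e2 : M ≤ M * Real.exp (K * t) :=
        le_mul_of_one_le_right hM.le (Real.one_le_exp (mul_nonneg hK0.le ht.1.le))
      simp only [loweredProfile, pow_zero, div_one]
      linarith [(hu x t ht).1]
    | succ n ih =>
      refine step _ (by positivity) ?_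
      have : 2 * (M / 2 ^ (n + 1)) = M / 2 ^ n := by
        rw [pow_succ]
        field_simp
      rwa [this]
  intro x t ht
  have hlim : Tendsto (fun n : ℕ => loweredProfile φ ε K (M / 2 ^ n)
      (clamp l (x - frameCenter c l s ε K t), t)) atTop
      (nhds ((1 + ε * Real.exp (-(K * t))) * φ (clamp l (x - frameCenter c l s ε K t))
        - 0 * Real.exp (K * t))) := by
    refine tendsto_const_nhds.sub (Tendsto.mul_const _ ?_)
    exact tendsto_const_nhds.div_atTop (tendsto_pow_atTop_atTop_of_one_lt one_lt_two)
  rw [zero_mul, sub_zero] at hlim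
  exact le_of_tendsto' hlim fun n => hall n x t ht

/-- In the renormalization setting, the moving subsolution profile stays
below the solution: `u(x,t) > φ₀(x - c₀t + l₀)` for `x ∈ [c₀t - 2l₀, c₀t]`, and consequently
the free boundary satisfies `b(t) > c₀ t` for every `t > 0`. -/
theorem free_boundary_moves_at_least_linearly
    (m : ℝ) (hm : 1 < m) (f : ℝ → ℝ → ℝ) (κ : ℝ → ℝ) (θ c₀ l₀ : ℝ) (φ₀ p : ℝ → ℝ)
    (u : ℝ → ℝ → ℝ) (b : ℝ → ℝ) (ty : ℝ → ℝ)
    (hset : RenormSetting m f κ θ c₀ l₀ φ₀ p u b ty) :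
    ∀ t > (0:ℝ),
      (∀ x ∈ Icc (c₀ * t - 2 * l₀) (c₀ * t), φ₀ (x - c₀ * t + l₀) < u x t) ∧
      c₀ * t < b t := by
  obtain ⟨h1, h2, hp, hp0, hper, -, -, hpφ, hsol, -, -, hfb, -, -, -, -, -⟩ := hset
  obtain rfl := h2.exponent_eq_two hm h1
  obtain ⟨φ1, φ2, hφ1c, hφ2c, hφ1, hφ2, hB, C₁, hC₁, hA⟩ := h2.profile_bounds h1
  obtain ⟨hc, hl, hφ, hφl', hφl, hφp, -, -⟩ := h2
  have hφc := hφ.continuousOn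
  intro T hT
  have hTI : T ∈ Ioc 0 T := ⟨hT, le_rfl⟩
  obtain ⟨huc, ⟨Mu, hMu⟩, -⟩ := hsol T hT
  have hu0 : ∀ x, ∀ t > (0:ℝ), 0 ≤ u x t := fun x t ht => by
    rcases lt_or_ge x (b t) with h | h
    · exact ((hfb t ht x).1 h).le
    · exact ((hfb t ht x).2 h).ge
  obtain ⟨Mp, hMp⟩ := isCompact_Icc.exists_bound_of_continuousOn
    (hp.continuous.continuousOn (s := Icc (0:ℝ) 1))
  have hpM : ∀ x, p x ≤ Mp := fun x => by
    have h := (show Function.Periodic p 1 from hper).sub_zsmul_eq ⌊x⌋ (x := x)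
    simp only [zsmul_eq_mul, mul_one] at h
    rw [← h]
    exact (le_abs_self _).trans (hMp _ ⟨Int.fract_nonneg x, (Int.fract_lt_one x).le⟩)
  obtain ⟨Mφ, hMφ⟩ := isCompact_Icc.exists_bound_of_continuousOn hφc
  obtain ⟨C₂, hC₂⟩ := isCompact_Icc.exists_bound_of_continuousOn hφ2c
  simp only [Real.norm_eq_abs] at hMφ hC₂
  have hll : l₀ ∈ Icc (-l₀) l₀ := ⟨by linarith, le_rfl⟩
  have hMφ0 : 0 ≤ Mφ := (abs_nonneg _).trans (hMφ _ hll)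
  have hC₂0 : 0 ≤ C₂ := (abs_nonneg _).trans (hC₂ _ hll)
  have hMu0 : 0 ≤ Mu := (abs_nonneg _).trans (hMu 0 T hTI)
  have hMp0 : 0 < Mp := (hp0 0).trans_le (hpM 0)
  set M := Mu + Mp + 2 * Mφ with hM
  have hM0 : 0 < M := by positivity
  obtain ⟨Λ, hΛ, hLip⟩ := h1.source_lipschitz M
  obtain ⟨hf, hκ, -, -, hf0, -⟩ := h1
  obtain ⟨ε, hε, hε1, hεp⟩ : ∃ ε > 0, ε ≤ 1 ∧ ∀ z ∈ Icc (-l₀) l₀, (1 + ε) * φ₀ z ≤ p (z - l₀) := by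
    obtain ⟨z₀, hz₀, hmin⟩ := isCompact_Icc.exists_isMinOn ⟨l₀, hll⟩
      ((hp.continuous.comp (continuous_id.sub continuous_const)).continuousOn.sub hφc :
        ContinuousOn (fun z => p (z - l₀) - φ₀ z) (Icc (-l₀) l₀))
    set d := p (z₀ - l₀) - φ₀ z₀ with hd
    have hd0 : 0 < d := by
      have := hpφ (-l₀) (z₀ - l₀) ⟨by linarith [hz₀.1], by linarith [hz₀.2]⟩
      rw [sub_neg_eq_add, sub_add_cancel] at this
      exact sub_pos.2 this
    refine ⟨min 1 (d / (Mφ + 1)), by positivity, min_le_left _ _, fun z hz => ?_⟩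
    have e1 : d ≤ p (z - l₀) - φ₀ z := hmin hz
    have e2 := (le_abs_self _).trans (hMφ z hz)
    have e3 : min 1 (d / (Mφ + 1)) * φ₀ z ≤ d / (Mφ + 1) * (Mφ + 1) :=
      (mul_le_mul_of_nonneg_left (by linarith) (by positivity)).trans
        (mul_le_mul_of_nonneg_right (min_le_right _ _) (by positivity))
    rw [div_mul_cancel₀ _ (by positivity)] at e3
    linarith
  set K := 4 * C₂ + 2 * C₁ + 3 * Λ + 1 + c₀ / l₀ with hKdef
  have hcl : 0 < c₀ / l₀ := by positivity
  have hK0 : 0 < K := by positivity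
  set u₀ : ℝ → ℝ := fun x => if x ≤ 0 then p x else 0 with hu₀def
  have hu₀M : ∀ x, u₀ x ∈ Icc 0 M := fun x => by
    simp only [hu₀def]
    split_ifs
    · exact ⟨(hp0 x).le, by linarith [hpM x]⟩
    · exact ⟨le_rfl, hM0.le⟩
  have huM : ∀ x, ∀ t ∈ Ioc 0 T, u x t ∈ Icc 0 M := fun x t ht =>
    ⟨hu0 x t ht.1, by linarith [(le_abs_self _).trans (hMu x t ht)]⟩
  have hu₀i : LocallyIntegrable u₀ := by
    refine (locallyIntegrable_const M).mono ?_ (Eventually.of_forall fun x => ?_)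
    · exact (Measurable.ite measurableSet_Iic hp.continuous.measurable
        measurable_const).aestronglyMeasurable
    · rw [Real.norm_eq_abs, Real.norm_eq_abs, abs_of_nonneg (hu₀M x).1]
      exact (hu₀M x).2.trans (le_abs_self _)
  have hav : ∀ τ ∈ Ioc 0 T, HasAverages τ (fun t => Real.exp (-(Λ * t)))
      (fun z t => Real.exp (Λ * t) * if t ≤ 0 then u₀ z else u z t)
      (fun z t => Real.exp (Λ * t) * (f z (u z t) * (κ z - u z t) + Λ * u z t)) := by
    intro τ hτ
    refine VeryWeakSol.hasAverages (C := Real.exp (Λ * τ) * (2 * Λ * M)) hτ.1 hf.continuous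
      hκ.continuous hu₀i (fun s hs => hsol s hs.1) fun z t ht => ?_
    have hut := huM z t ⟨ht.1, ht.2.trans hτ.2⟩
    have g := hLip z z _ _ (by simp) hut ⟨le_rfl, hM0.le⟩
    rw [hf0] at g
    simp only [zero_mul, sub_zero, sub_self, abs_zero, zero_add, abs_of_nonneg hut.1] at g
    have g' := mul_le_mul_of_nonneg_left hut.2 hΛ.le
    rw [abs_mul, abs_of_pos (Real.exp_pos _)]
    refine mul_le_mul (Real.exp_le_exp.2 (mul_le_mul_of_nonneg_left ht.2 hΛ.le)) ?_
      (abs_nonneg _) (Real.exp_pos _).le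
    rw [abs_le]
    constructor <;> linarith [(abs_le.1 g).1, (abs_le.1 g).2, mul_nonneg hΛ.le hut.1]
  have hinit : ∀ x, (1 + ε) * φ₀ (clamp l₀ (x + l₀)) ≤ u₀ x := by
    intro x
    rcases lt_or_ge 0 x with hx | hx
    · have : clamp l₀ (x + l₀) = l₀ := by
        rw [clamp, min_eq_left (by linarith), max_eq_right (by linarith)]
      rw [this, hφl, mul_zero]
      exact (hu₀M x).1
    rcases lt_or_ge x (-(2 * l₀)) with hx' | hx'
    · have : clamp l₀ (x + l₀) = -l₀ := by
        rw [clamp, max_eq_left ((min_le_right _ _).trans (by linarith))]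
      rw [this, hφl', mul_zero]
      exact (hu₀M x).1
    · have hmem : x + l₀ ∈ Icc (-l₀) l₀ := ⟨by linarith, by linarith⟩
      have := hεp _ hmem
      rw [add_sub_cancel_right] at this
      rw [clamp_of_mem hmem]
      simpa only [hu₀def, if_pos hx] using this
  have hmain : ∀ s, 0 ≤ s → s ≤ c₀ → ∀ x, (1 + ε * Real.exp (-(K * T))) *
      φ₀ (clamp l₀ (x - frameCenter c₀ l₀ s ε K T)) ≤ u x T := fun s hs hsc x =>
    travelling_profile_le hl hM0 hΛ hC₁ hs hsc hε.le hε1 (by linarith) hφc hφ1c hφ2c hφl' hφl hφp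
      (fun z hz => by linarith [(le_abs_self _).trans (hMφ z hz)]) hφ1 hφ2 hB hA hC₂ hf0 hLip
      hu₀M huM huc hav hinit x T hTI
  have hη : 0 < ε * Real.exp (-(K * T)) := by positivity
  have hfront : c₀ * T < b T := by
    by_contra! hn
    have h0 := (hfb T hT (c₀ * T)).2 hn
    have h := hmain c₀ hc.le le_rfl (c₀ * T)
    set δ := c₀ * ε * (1 - Real.exp (-(K * T))) / K with hδ
    have he : Real.exp (-(K * T)) < 1 := Real.exp_lt_one_iff.2 (by
      have := mul_pos hK0 hT
      linarith)
    have hδ0 : 0 < δ := div_pos (mul_pos (mul_pos hc hε) (sub_pos.2 he)) hK0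
    have hδl : δ ≤ l₀ := by
      rw [hδ, div_le_iff₀ hK0]
      have e1 : c₀ * ε * (1 - Real.exp (-(K * T))) ≤ c₀ * 1 * 1 := by
        gcongr
        linarith [Real.exp_pos (-(K * T))]
      have e2 : l₀ * (c₀ / l₀) ≤ l₀ * K := mul_le_mul_of_nonneg_left (by linarith) hl.le
      rw [mul_div_cancel₀ _ hl.ne'] at e2
      linarith
    have hz : c₀ * T - frameCenter c₀ l₀ c₀ ε K T = l₀ - δ := by
      rw [frameCenter]
      ring
    have hzI : l₀ - δ ∈ Ioo (-l₀) l₀ := ⟨by linarith, by linarith⟩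
    rw [hz, clamp_of_mem (Ioo_subset_Icc_self hzI), h0] at h
    have := hφp _ hzI
    exact h.not_gt (by positivity)
  refine ⟨fun x hx => ?_, hfront⟩
  have hux : 0 < u x T := (hfb T hT x).1 (hx.2.trans_lt hfront)
  set z := x - c₀ * T + l₀ with hz
  have hzI : z ∈ Icc (-l₀) l₀ := ⟨by linarith [hx.1], by linarith [hx.2]⟩
  rcases hzI.1.eq_or_lt with h | h
  · rwa [← h, hφl']
  rcases hzI.2.eq_or_lt with h' | h'
  · rwa [h', hφl]
  · have hm := hmain 0 le_rfl hc.le x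
    have he : x - frameCenter c₀ l₀ 0 ε K T = z := by
      rw [frameCenter, hz]
      ring
    rw [he, clamp_of_mem hzI] at hm
    have := mul_pos hη (hφp z ⟨h, h'⟩)
    linarith
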